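/- arXiv:0810.0230 — 7 statements merged into one kernel-verified Lean document; each statement's English description precedes it below -/
import Mathlib

section
/- Let X be a separable Banach space and let (T(t))_{t≥0} be a strongly continuous semigroup on X satisfying the hypercyclicity criterion. Then for every natural number n ≥ 1 the diagonal semigroup T^n(t) := T(t) × ⋯ × T(t) (n factors), acting on the product Banach space X^n = X × ⋯ × X equipped with the sup norm ‖(x_1,…,x_n)‖ = sup_k ‖x_k‖, is hypercyclic, i.e. there exists a point z ∈ X^n whose orbit {T^n(t)z : t ≥ 0} is dense in X^n. -/
open Set Filter Topology TensorProduct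

/-- A strongly continuous (C₀-) semigroup on a normed space. -/
def IsC0Semigroup {X : Type*} [NormedAddCommGroup X] [NormedSpace ℝ X]
    (T : ℝ → X →L[ℝ] X) : Prop :=
  T 0 = ContinuousLinearMap.id ℝ X ∧
  (∀ s t : ℝ, 0 ≤ s → 0 ≤ t → T (s + t) = (T s).comp (T t)) ∧
  (∀ x : X, ContinuousOn (fun t => T t x) (Ici (0 : ℝ)))

/-- The semigroup is hypercyclic: some orbit `{T(t)x : t ≥ 0}` is dense. -/
def IsHypercyclicSg {X : Type*} [NormedAddCommGroup X] [NormedSpace ℝ X]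
    (T : ℝ → X →L[ℝ] X) : Prop :=
  ∃ x : X, Dense {y : X | ∃ t : ℝ, 0 ≤ t ∧ T t x = y}

/-- The hypercyclicity criterion. -/
def SatisfiesHC {X : Type*} [NormedAddCommGroup X] [NormedSpace ℝ X]
    (T : ℝ → X →L[ℝ] X) : Prop :=
  ∀ U V W : Set X, IsOpen U → IsOpen V → IsOpen W →
    U.Nonempty → V.Nonempty → (0 : X) ∈ W →
    ∃ t : ℝ, 0 < t ∧ (T t '' U ∩ W).Nonempty ∧ (T t '' W ∩ V).Nonempty

/-- The recurrent hypercyclicity criterion. -/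
def SatisfiesRHC {X : Type*} [NormedAddCommGroup X] [NormedSpace ℝ X]
    (T : ℝ → X →L[ℝ] X) : Prop :=
  ∀ U V W : Set X, IsOpen U → IsOpen V → IsOpen W →
    U.Nonempty → V.Nonempty → (0 : X) ∈ W →
    ∃ L : ℝ, 0 ≤ L ∧ ∀ t : ℝ, 0 ≤ t → ∃ s ∈ Icc t (t + L),
      (T s '' U ∩ W).Nonempty ∧ (T s '' W ∩ V).Nonempty

/-- The semigroup is chaotic: hypercyclic with a dense set of periodic points. -/
def IsChaoticSg {X : Type*} [NormedAddCommGroup X] [NormedSpace ℝ X]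
    (T : ℝ → X →L[ℝ] X) : Prop :=
  (∃ x : X, Dense {y : X | ∃ t : ℝ, 0 ≤ t ∧ T t x = y}) ∧
  Dense {x : X | ∃ t : ℝ, 0 < t ∧ T t x = x}

/-- The diagonal semigroup `T(t) × ⋯ × T(t)` (n factors) acting on `Xⁿ` with the sup norm. -/
noncomputable def diagSg {X : Type*} [NormedAddCommGroup X] [NormedSpace ℝ X]
    (T : ℝ → X →L[ℝ] X) (n : ℕ) : ℝ → (Fin n → X) →L[ℝ] (Fin n → X) :=
  fun t => ContinuousLinearMap.pi (fun i => (T t).comp (ContinuousLinearMap.proj i))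

/-- If `S` maps a point near `a` close to `0`, and a small vector close to `b`, then it maps a point
near `a` close to `b`. -/
theorem exists_mem_ball_map_mem_ball {X : Type*} [NormedAddCommGroup X] [NormedSpace ℝ X]
    (S : X →L[ℝ] X) {a b : X} {ε : ℝ}
    (h₁ : (S '' Metric.ball a (ε / 2) ∩ Metric.ball 0 (ε / 2)).Nonempty)
    (h₂ : (S '' Metric.ball 0 (ε / 2) ∩ Metric.ball b (ε / 2)).Nonempty) :
    ∃ x ∈ Metric.ball a ε, S x ∈ Metric.ball b ε := by
  obtain ⟨_, ⟨u, hu, rfl⟩, hSu⟩ := h₁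
  obtain ⟨_, ⟨w, hw, rfl⟩, hSw⟩ := h₂
  rw [Metric.mem_ball, dist_eq_norm] at hu hSu hw hSw
  rw [sub_zero] at hSu hw
  refine ⟨u + w, ?_, ?_⟩
  · rw [Metric.mem_ball, dist_eq_norm, add_sub_right_comm]
    linarith [norm_add_le (u - a) w]
  · rw [Metric.mem_ball, dist_eq_norm, map_add, add_sub_assoc]
    linarith [norm_add_le (S u) (S w - b)]

/-- The hypercyclicity criterion implies topological transitivity. -/
theorem SatisfiesHC.exists_mem_map_mem {X : Type*} [NormedAddCommGroup X] [NormedSpace ℝ X]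
    {T : ℝ → X →L[ℝ] X} (hHC : SatisfiesHC T) {U V : Set X} (hU : IsOpen U) (hV : IsOpen V)
    (hU' : U.Nonempty) (hV' : V.Nonempty) :
    ∃ t : ℝ, 0 < t ∧ ∃ x ∈ U, T t x ∈ V := by
  obtain ⟨a, ha⟩ := hU'
  obtain ⟨b, hb⟩ := hV'
  obtain ⟨δ, hδ, hδU⟩ := Metric.isOpen_iff.1 hU a ha
  obtain ⟨η, hη, hηV⟩ := Metric.isOpen_iff.1 hV b hb
  have hε : 0 < min δ η / 2 := half_pos (lt_min hδ hη)
  obtain ⟨t, ht, h₁, h₂⟩ := hHC (Metric.ball a (min δ η / 2)) (Metric.ball b (min δ η / 2))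
    (Metric.ball 0 (min δ η / 2)) Metric.isOpen_ball Metric.isOpen_ball Metric.isOpen_ball
    ⟨a, Metric.mem_ball_self hε⟩ ⟨b, Metric.mem_ball_self hε⟩ (Metric.mem_ball_self hε)
  obtain ⟨x, hx, hTx⟩ := exists_mem_ball_map_mem_ball (T t) h₁ h₂
  exact ⟨t, ht, x, hδU (Metric.ball_subset_ball (min_le_left _ _) hx),
    hηV (Metric.ball_subset_ball (min_le_right _ _) hTx)⟩

/-- Finitely many nonempty open sets receive a common nonempty open set under suitable operators of
the semigroup. -/
theorem SatisfiesHC.exists_isOpen_mapsTo {X : Type*} [NormedAddCommGroup X] [NormedSpace ℝ X]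
    {T : ℝ → X →L[ℝ] X} (hHC : SatisfiesHC T) {n : ℕ} (U : Fin n → Set X)
    (hU : ∀ i, IsOpen (U i)) (hU' : ∀ i, (U i).Nonempty) :
    ∃ (A : Set X) (s : Fin n → ℝ), IsOpen A ∧ A.Nonempty ∧ (∀ i, 0 ≤ s i) ∧
      ∀ i, MapsTo (T (s i)) A (U i) := by
  induction n with
  | zero => exact ⟨univ, Fin.elim0, isOpen_univ, univ_nonempty, fun i => i.elim0, fun i => i.elim0⟩
  | succ n ih =>
    obtain ⟨A, s, hA, hA', hs, hsA⟩ := ih (fun i => U i.succ) (fun i => hU _) (fun i => hU' _)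
    obtain ⟨r, hr, x, hx, hrx⟩ := hHC.exists_mem_map_mem hA (hU 0) hA' (hU' 0)
    refine ⟨A ∩ T r ⁻¹' U 0, Fin.cons r s, hA.inter ((hU 0).preimage (T r).continuous),
      ⟨x, hx, hrx⟩, Fin.cases hr.le hs, Fin.cases (fun y hy => hy.2) fun i y hy => hsA i hy.1⟩

/-- The hypercyclicity criterion holds simultaneously for finitely many pairs of open sets. -/
theorem SatisfiesHC.exists_forall_nonempty {X : Type*} [NormedAddCommGroup X] [NormedSpace ℝ X]
    {T : ℝ → X →L[ℝ] X} (hHC : SatisfiesHC T)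
    (hT : ∀ s t : ℝ, 0 ≤ s → 0 ≤ t → T (s + t) = (T s).comp (T t)) {n : ℕ}
    (U V : Fin n → Set X) {W : Set X} (hU : ∀ i, IsOpen (U i)) (hV : ∀ i, IsOpen (V i))
    (hW : IsOpen W) (hU' : ∀ i, (U i).Nonempty) (hV' : ∀ i, (V i).Nonempty) (h0 : (0 : X) ∈ W) :
    ∃ t : ℝ, 0 < t ∧ ∀ i, (T t '' U i ∩ W).Nonempty ∧ (T t '' W ∩ V i).Nonempty := by
  have comm : ∀ s t : ℝ, 0 ≤ s → 0 ≤ t → ∀ x, T s (T t x) = T t (T s x) := by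
    intro s t hs ht x
    rw [← ContinuousLinearMap.comp_apply, ← hT s t hs ht, add_comm, hT t s ht hs,
      ContinuousLinearMap.comp_apply]
  obtain ⟨A, s, hA, hA', hs, hsA⟩ := hHC.exists_isOpen_mapsTo U hU hU'
  obtain ⟨B, r, hB, hB', hr, hrB⟩ := hHC.exists_isOpen_mapsTo V hV hV'
  obtain ⟨t, ht, ⟨_, ⟨u, hu, rfl⟩, hTu⟩, ⟨_, ⟨w, hw, rfl⟩, hTw⟩⟩ :=
    hHC A B (⋂ i, T (s i) ⁻¹' W ∩ T (r i) ⁻¹' W) hA hB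
      (isOpen_iInter_of_finite fun i =>
        (hW.preimage (T (s i)).continuous).inter (hW.preimage (T (r i)).continuous))
      hA' hB' (by simpa using fun _ => h0)
  rw [mem_iInter] at hTu hw
  refine ⟨t, ht, fun i => ⟨⟨_, mem_image_of_mem _ (hsA i hu), ?_⟩,
    ⟨_, mem_image_of_mem _ (hw i).2, ?_⟩⟩⟩
  · rw [comm t (s i) ht.le (hs i)]
    exact (hTu i).1
  · rw [comm t (r i) ht.le (hr i)]
    exact hrB i hTw

/-- Under the hypercyclicity criterion, the diagonal semigroups are topologically transitive. -/
theorem SatisfiesHC.exists_mem_diagSg_mem {X : Type*} [NormedAddCommGroup X] [NormedSpace ℝ X]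
    {T : ℝ → X →L[ℝ] X} (hHC : SatisfiesHC T)
    (hT : ∀ s t : ℝ, 0 ≤ s → 0 ≤ t → T (s + t) = (T s).comp (T t)) {n : ℕ}
    {U V : Set (Fin n → X)} (hU : IsOpen U) (hV : IsOpen V)
    (hU' : U.Nonempty) (hV' : V.Nonempty) :
    ∃ t : ℝ, 0 < t ∧ ∃ x ∈ U, diagSg T n t x ∈ V := by
  obtain ⟨a, ha⟩ := hU'
  obtain ⟨b, hb⟩ := hV'
  obtain ⟨δ, hδ, hδU⟩ := Metric.isOpen_iff.1 hU a ha
  obtain ⟨η, hη, hηV⟩ := Metric.isOpen_iff.1 hV b hb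
  have hmin : 0 < min δ η := lt_min hδ hη
  have hε : 0 < min δ η / 2 := half_pos hmin
  obtain ⟨t, ht, h⟩ := hHC.exists_forall_nonempty hT
    (fun i => Metric.ball (a i) (min δ η / 2)) (fun i => Metric.ball (b i) (min δ η / 2))
    (fun _ => Metric.isOpen_ball) (fun _ => Metric.isOpen_ball) Metric.isOpen_ball
    (fun i => ⟨a i, Metric.mem_ball_self hε⟩) (fun i => ⟨b i, Metric.mem_ball_self hε⟩)
    (Metric.mem_ball_self hε)
  choose x hx hTx using fun i => exists_mem_ball_map_mem_ball (T t) (h i).1 (h i).2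
  exact ⟨t, ht, x,
    hδU (Metric.ball_subset_ball (min_le_left _ _) ((dist_pi_lt_iff hmin).2 hx)),
    hηV (Metric.ball_subset_ball (min_le_right _ _) ((dist_pi_lt_iff hmin).2 hTx))⟩

/-- Birkhoff's transitivity theorem for families of operators indexed by `t ≥ 0`. -/
theorem isHypercyclicSg_of_transitive {X : Type*} [NormedAddCommGroup X] [NormedSpace ℝ X]
    [CompleteSpace X] [TopologicalSpace.SeparableSpace X] {T : ℝ → X →L[ℝ] X}
    (h : ∀ U V : Set X, IsOpen U → IsOpen V → U.Nonempty → V.Nonempty →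
      ∃ t : ℝ, 0 ≤ t ∧ ∃ x ∈ U, T t x ∈ V) :
    IsHypercyclicSg T := by
  have := UniformSpace.secondCountable_of_separable X
  obtain ⟨B, hBc, hBe, hB⟩ := TopologicalSpace.exists_countable_basis X
  have hdense : Dense (⋂ V ∈ B, ⋃ t ∈ Ici (0 : ℝ), T t ⁻¹' V) := by
    refine dense_biInter_of_isOpen (fun V hV => ?_) hBc (fun V hV => ?_)
    · exact isOpen_biUnion fun t _ => (hB.isOpen hV).preimage (T t).continuous
    · refine dense_iff_inter_open.2 fun U hU hU' => ?_
      obtain ⟨t, ht, x, hx, hTx⟩ := h U V hU (hB.isOpen hV) hU'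
        (nonempty_iff_ne_empty.2 fun hne => hBe (hne ▸ hV))
      exact ⟨x, hx, mem_biUnion (mem_Ici.2 ht) hTx⟩
  obtain ⟨z, hz⟩ := hdense.nonempty
  refine ⟨z, hB.dense_iff.2 fun V hV _ => ?_⟩
  obtain ⟨t, ht, hTz⟩ := mem_iUnion₂.1 (mem_iInter₂.1 hz V hV)
  exact ⟨T t z, hTz, t, ht, rfl⟩

theorem diagonal_semigroup_hypercyclic
    {X : Type*} [NormedAddCommGroup X] [NormedSpace ℝ X] [CompleteSpace X]
    [TopologicalSpace.SeparableSpace X]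
    (T : ℝ → X →L[ℝ] X) (hT : IsC0Semigroup T) (hHC : SatisfiesHC T)
    (n : ℕ) (hn : 1 ≤ n) :
    IsHypercyclicSg (diagSg T n) := by
  refine isHypercyclicSg_of_transitive fun U V hU hV hU' hV' => ?_
  obtain ⟨t, ht, hx⟩ := hHC.exists_mem_diagSg_mem hT.2.1 hU hV hU' hV'
  exact ⟨t, ht.le, hx⟩
end

section
/- Let X and Y be separable Banach spaces, let (T(t))_{t≥0} and (S(t))_{t≥0} be strongly continuous semigroups on X and Y respectively, and let α be a uniform crossnorm on the algebraic tensor product X ⊗ Y. Assume that T(t) satisfies the recurrent hypercyclicity criterion and that S(t) satisfies the hypercyclicity criterion. Then the tensor product semigroup T(t) ⊗ S(t), acting on the completion X ⊗̃_α Y of the normed space (X ⊗ Y, α), satisfies the hypercyclicity criterion. -/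
open Set Filter Topology TensorProduct

/-- A uniform crossnorm on the algebraic tensor product `X ⊗ Y`. -/
structure UniformCrossNorm (X Y : Type*) [NormedAddCommGroup X] [NormedSpace ℝ X]
    [NormedAddCommGroup Y] [NormedSpace ℝ Y] where
  α : TensorProduct ℝ X Y → ℝ
  α_nonneg : ∀ z, 0 ≤ α z
  α_eq_zero_iff : ∀ z, α z = 0 ↔ z = 0
  α_add_le : ∀ z w, α (z + w) ≤ α z + α w
  α_smul : ∀ (c : ℝ) z, α (c • z) = |c| * α z
  α_cross : ∀ (x : X) (y : Y), α (x ⊗ₜ[ℝ] y) = ‖x‖ * ‖y‖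
  α_uniform : ∀ (T : X →L[ℝ] X) (S : Y →L[ℝ] Y) (z : TensorProduct ℝ X Y),
    α (TensorProduct.map (T : X →ₗ[ℝ] X) (S : Y →ₗ[ℝ] Y) z) ≤ ‖T‖ * ‖S‖ * α z

section Auxiliary

variable {X : Type*} [NormedAddCommGroup X] [NormedSpace ℝ X] {T : ℝ → X →L[ℝ] X}

lemma IsC0Semigroup.add_apply (hT : IsC0Semigroup T) {s t : ℝ} (hs : 0 ≤ s) (ht : 0 ≤ t) (x : X) :
    T (s + t) x = T s (T t x) := by
  rw [hT.2.1 s t hs ht]; rfl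

lemma IsC0Semigroup.comm_apply (hT : IsC0Semigroup T) {s t : ℝ} (hs : 0 ≤ s) (ht : 0 ≤ t) (x : X) :
    T s (T t x) = T t (T s x) := by
  rw [← hT.add_apply hs ht, ← hT.add_apply ht hs, add_comm]

/-- On a Banach space, a strongly continuous semigroup is equicontinuous on bounded time
intervals. -/
lemma IsC0Semigroup.exists_nhds_zero [CompleteSpace X] (hT : IsC0Semigroup T) (L : ℝ)
    {W : Set X} (hW : IsOpen W) (h0 : (0 : X) ∈ W) :
    ∃ W' : Set X, IsOpen W' ∧ (0 : X) ∈ W' ∧ ∀ r ∈ Icc 0 L, ∀ x ∈ W', T r x ∈ W := by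
  obtain ⟨C, hC⟩ := banach_steinhaus (g := fun r : Icc (0 : ℝ) L => T r) fun x => by
    obtain ⟨C, hC⟩ := isCompact_Icc.exists_bound_of_continuousOn
      ((hT.2.2 x).mono (Icc_subset_Ici_self : Icc (0 : ℝ) L ⊆ Ici 0))
    exact ⟨C, fun r => hC r r.2⟩
  obtain ⟨ε, hε, hεW⟩ := Metric.isOpen_iff.1 hW 0 h0
  have hD : 0 < |C| + 1 := by positivity
  refine ⟨Metric.ball 0 (ε / (|C| + 1)), Metric.isOpen_ball,
    Metric.mem_ball_self (div_pos hε hD), fun r hr x hx => hεW ?_⟩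
  rw [mem_ball_zero_iff] at hx ⊢
  calc ‖T r x‖ ≤ ‖T r‖ * ‖x‖ := (T r).le_opNorm x
    _ ≤ (|C| + 1) * ‖x‖ := by
        gcongr
        exact (hC ⟨r, hr⟩).trans ((le_abs_self C).trans (by linarith))
    _ < ε := by rwa [lt_div_iff₀' hD] at hx

lemma SatisfiesRHC.satisfiesHC (h : SatisfiesRHC T) : SatisfiesHC T := by
  intro U V W hU hV hW hUn hVn h0
  obtain ⟨L, -, hL⟩ := h U V W hU hV hW hUn hVn h0
  obtain ⟨s, hs, h⟩ := hL 1 zero_le_one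
  exact ⟨s, lt_of_lt_of_le one_pos hs.1, h⟩

/-- The hypercyclicity criterion implies topological transitivity. -/
lemma SatisfiesHC.transitive (h : SatisfiesHC T) {U V : Set X} (hU : IsOpen U) (hV : IsOpen V)
    (hUn : U.Nonempty) (hVn : V.Nonempty) : ∃ t, 0 < t ∧ ∃ x ∈ U, T t x ∈ V := by
  obtain ⟨u, hu⟩ := hUn
  obtain ⟨v, hv⟩ := hVn
  obtain ⟨ε, hε, hεU⟩ := Metric.isOpen_iff.1 hU u hu
  obtain ⟨δ, hδ, hδV⟩ := Metric.isOpen_iff.1 hV v hv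
  obtain ⟨t, ht, ⟨_, ⟨x, hx, rfl⟩, hTx⟩, ⟨_, ⟨w, hw, rfl⟩, hTw⟩⟩ :=
    h (Metric.ball u (ε / 2)) (Metric.ball v (δ / 2)) (Metric.ball 0 (min (ε / 2) (δ / 2)))
      Metric.isOpen_ball Metric.isOpen_ball Metric.isOpen_ball
      ⟨u, Metric.mem_ball_self (by positivity)⟩ ⟨v, Metric.mem_ball_self (by positivity)⟩
      (Metric.mem_ball_self (by positivity))
  rw [mem_ball_zero_iff, lt_min_iff] at hTx hw
  rw [mem_ball_iff_norm] at hx hTw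
  refine ⟨t, ht, x + w, hεU ?_, hδV ?_⟩
  · rw [mem_ball_iff_norm, add_sub_right_comm]
    exact (norm_add_le _ _).trans_lt (by linarith [hw.1])
  · rw [mem_ball_iff_norm, map_add, add_sub_assoc]
    exact (norm_add_le _ _).trans_lt (by linarith [hTx.2])

/-- A single open set whose passage to a neighbourhood of zero forces that of finitely many
given open sets. -/
lemma SatisfiesHC.exists_source (h : SatisfiesHC T) (hT : IsC0Semigroup T) {n : ℕ}
    (U : Fin n → Set X) (hU : ∀ i, IsOpen (U i)) (hUn : ∀ i, (U i).Nonempty)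
    {W : Set X} (hW : IsOpen W) (h0 : (0 : X) ∈ W) :
    ∃ U' W' : Set X, IsOpen U' ∧ U'.Nonempty ∧ IsOpen W' ∧ (0 : X) ∈ W' ∧
      ∀ t, 0 ≤ t → (T t '' U' ∩ W').Nonempty → ∀ i, (T t '' U i ∩ W).Nonempty := by
  induction n with
  | zero => exact ⟨univ, univ, isOpen_univ, ⟨0, trivial⟩, isOpen_univ, trivial, fun _ _ _ i => i.elim0⟩
  | succ n ih =>
    obtain ⟨U₁, W₁, hU₁, hU₁n, hW₁, h0₁, h₁⟩ :=
      ih (fun i => U i.succ) (fun i => hU _) (fun i => hUn _)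
    obtain ⟨s, hs, x, hx, hsx⟩ := h.transitive hU₁ (hU 0) hU₁n (hUn 0)
    refine ⟨U₁ ∩ T s ⁻¹' U 0, W₁ ∩ T s ⁻¹' W, hU₁.inter ((hU 0).preimage (T s).continuous),
      ⟨x, hx, hsx⟩, hW₁.inter (hW.preimage (T s).continuous), ⟨h0₁, by simpa using h0⟩, ?_⟩
    rintro t ht ⟨_, ⟨u, ⟨hu, hsu⟩, rfl⟩, hw, hsw⟩ i
    refine Fin.cases ?_ (fun i => ?_) i
    · refine ⟨_, ⟨T s u, hsu, rfl⟩, ?_⟩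
      rw [hT.comm_apply ht hs.le]
      exact hsw
    · exact h₁ t ht ⟨_, ⟨u, hu, rfl⟩, hw⟩ i

/-- A single open set whose reachability from a neighbourhood of zero forces that of finitely many
given open sets. -/
lemma SatisfiesHC.exists_target (h : SatisfiesHC T) (hT : IsC0Semigroup T) {n : ℕ}
    (V : Fin n → Set X) (hV : ∀ i, IsOpen (V i)) (hVn : ∀ i, (V i).Nonempty)
    {W : Set X} (hW : IsOpen W) (h0 : (0 : X) ∈ W) :
    ∃ V' W' : Set X, IsOpen V' ∧ V'.Nonempty ∧ IsOpen W' ∧ (0 : X) ∈ W' ∧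
      ∀ t, 0 ≤ t → (T t '' W' ∩ V').Nonempty → ∀ i, (T t '' W ∩ V i).Nonempty := by
  induction n with
  | zero => exact ⟨univ, univ, isOpen_univ, ⟨0, trivial⟩, isOpen_univ, trivial, fun _ _ _ i => i.elim0⟩
  | succ n ih =>
    obtain ⟨V₁, W₁, hV₁, hV₁n, hW₁, h0₁, h₁⟩ :=
      ih (fun i => V i.succ) (fun i => hV _) (fun i => hVn _)
    obtain ⟨s, hs, x, hx, hsx⟩ := h.transitive hV₁ (hV 0) hV₁n (hVn 0)
    refine ⟨V₁ ∩ T s ⁻¹' V 0, W₁ ∩ T s ⁻¹' W, hV₁.inter ((hV 0).preimage (T s).continuous),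
      ⟨x, hx, hsx⟩, hW₁.inter (hW.preimage (T s).continuous), ⟨h0₁, by simpa using h0⟩, ?_⟩
    rintro t ht ⟨_, ⟨w, ⟨hw, hsw⟩, rfl⟩, hv, hsv⟩ i
    refine Fin.cases ?_ (fun i => ?_) i
    · refine ⟨_, ⟨T s w, hsw, rfl⟩, ?_⟩
      rw [hT.comm_apply ht hs.le]
      exact hsv
    · exact h₁ t ht ⟨_, ⟨w, hw, rfl⟩, hv⟩ i

/-- The hypercyclicity criterion, reduced to single open sets, for finite families of vectors. -/
lemma SatisfiesHC.exists_approx (h : SatisfiesHC T) (hT : IsC0Semigroup T) {n m : ℕ}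
    (u : Fin n → X) (v : Fin m → X) {ε : ℝ} (hε : 0 < ε) :
    ∃ U V W : Set X, IsOpen U ∧ IsOpen V ∧ IsOpen W ∧ U.Nonempty ∧ V.Nonempty ∧ (0 : X) ∈ W ∧
      ∀ t, 0 ≤ t → (T t '' U ∩ W).Nonempty → (T t '' W ∩ V).Nonempty →
        (∃ x ∈ Metric.ball u ε, (fun i => T t (x i)) ∈ Metric.ball 0 ε) ∧
        ∃ w ∈ Metric.ball (0 : Fin m → X) ε, (fun i => T t (w i)) ∈ Metric.ball v ε := by
  obtain ⟨U, W₁, hU, hUn, hW₁, h0₁, h₁⟩ := h.exists_source hT (fun i => Metric.ball (u i) ε)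
    (fun _ => Metric.isOpen_ball) (fun i => ⟨u i, Metric.mem_ball_self hε⟩)
    (Metric.isOpen_ball (x := (0 : X)) (ε := ε)) (Metric.mem_ball_self hε)
  obtain ⟨V, W₂, hV, hVn, hW₂, h0₂, h₂⟩ := h.exists_target hT (fun i => Metric.ball (v i) ε)
    (fun _ => Metric.isOpen_ball) (fun i => ⟨v i, Metric.mem_ball_self hε⟩)
    (Metric.isOpen_ball (x := (0 : X)) (ε := ε)) (Metric.mem_ball_self hε)
  refine ⟨U, V, W₁ ∩ W₂, hU, hV, hW₁.inter hW₂, hUn, hVn, ⟨h0₁, h0₂⟩, fun t ht hu hv => ⟨?_, ?_⟩⟩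
  · have := h₁ t ht (hu.mono (inter_subset_inter_right _ inter_subset_left))
    choose y hy hyW using this
    choose x hx hxy using hy
    refine ⟨x, (dist_pi_lt_iff hε).2 hx, (dist_pi_lt_iff hε).2 fun i => ?_⟩
    rw [hxy]
    exact hyW i
  · have := h₂ t ht (hv.mono (inter_subset_inter_left _ (image_mono inter_subset_right)))
    choose y hy hyV using this
    choose w hw hwy using hy
    refine ⟨w, (dist_pi_lt_iff hε).2 hw, (dist_pi_lt_iff hε).2 fun i => ?_⟩
    rw [hwy]
    exact hyV i

/-- On a nontrivial space the times in the hypercyclicity criterion can be taken arbitrarily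
large. -/
lemma SatisfiesHC.exists_gt [CompleteSpace X] [Nontrivial X] (h : SatisfiesHC T)
    (hT : IsC0Semigroup T) (L : ℝ) {U V W : Set X} (hU : IsOpen U) (hV : IsOpen V)
    (hW : IsOpen W) (hUn : U.Nonempty) (hVn : V.Nonempty) (h0 : (0 : X) ∈ W) :
    ∃ t, 0 < t ∧ L < t ∧ (T t '' U ∩ W).Nonempty ∧ (T t '' W ∩ V).Nonempty := by
  have : (𝓝[≠] (0 : X)).NeBot := Module.punctured_nhds_neBot ℝ X 0
  obtain ⟨v, hv, hv0⟩ := (dense_compl_singleton (0 : X)).inter_open_nonempty V hV hVn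
  have hv0 : 0 < ‖v‖ := norm_pos_iff.2 hv0
  obtain ⟨W₁, hW₁, h0₁, h₁⟩ := hT.exists_nhds_zero L
    (Metric.isOpen_ball (x := (0 : X)) (ε := ‖v‖ / 2)) (Metric.mem_ball_self (half_pos hv0))
  obtain ⟨t, ht, hu, _, ⟨w, hw, rfl⟩, hwV, hwn⟩ := h U (V ∩ {y | ‖v‖ / 2 < ‖y‖}) (W ∩ W₁) hU
    (hV.inter (isOpen_lt continuous_const continuous_norm)) (hW.inter hW₁) hUn
    ⟨v, hv, half_lt_self hv0⟩ ⟨h0, h0₁⟩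
  refine ⟨t, ht, ?_, hu.mono (inter_subset_inter_right _ inter_subset_left),
    ⟨_, ⟨w, hw.1, rfl⟩, hwV⟩⟩
  by_contra! htL
  have := h₁ t ⟨ht.le, htL⟩ w hw.2
  rw [mem_ball_zero_iff] at this
  exact lt_asymm this hwn

/-- On a nontrivial space the set of times in the hypercyclicity criterion contains arbitrarily
long intervals. -/
lemma SatisfiesHC.exists_Icc [CompleteSpace X] [Nontrivial X] (h : SatisfiesHC T)
    (hT : IsC0Semigroup T) {L : ℝ} (hL : 0 ≤ L) {U V W : Set X} (hU : IsOpen U) (hV : IsOpen V)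
    (hW : IsOpen W) (hUn : U.Nonempty) (hVn : V.Nonempty) (h0 : (0 : X) ∈ W) :
    ∃ a, 0 < a ∧ ∀ s ∈ Icc a (a + L), (T s '' U ∩ W).Nonempty ∧ (T s '' W ∩ V).Nonempty := by
  have hU' : (T L ⁻¹' U).Nonempty := by
    obtain ⟨t, -, htL, -, _, ⟨w, -, rfl⟩, hwU⟩ := h.exists_gt hT L hU hU hW hUn hUn h0
    refine ⟨T (t - L) w, ?_⟩
    rw [mem_preimage, ← hT.add_apply hL (sub_nonneg.2 htL.le), add_sub_cancel]
    exact hwU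
  obtain ⟨W₁, hW₁, h0₁, h₁⟩ := hT.exists_nhds_zero L hW h0
  obtain ⟨t, ht, htL, ⟨_, ⟨u, hu, rfl⟩, huW⟩, ⟨_, ⟨w, hw, rfl⟩, hwV⟩⟩ :=
    h.exists_gt hT L (hU.preimage (T L).continuous) hV hW₁ hU' hVn h0₁
  refine ⟨t - L, sub_pos.2 htL, fun s hs => ⟨⟨_, ⟨T L u, hu, rfl⟩, ?_⟩,
    ⟨_, ⟨T (t - s) w, h₁ _ ⟨?_, ?_⟩ w hw, rfl⟩, ?_⟩⟩⟩
  · have := h₁ (s - (t - L)) ⟨by linarith [hs.1], by linarith [hs.2]⟩ _ huW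
    rw [← hT.add_apply (by linarith [hs.1]) ht.le] at this
    rw [← hT.add_apply (by linarith [hs.1]) hL]
    convert this using 3
    ring
  · linarith [hs.2]
  · linarith [hs.1]
  · rw [← hT.add_apply (by linarith [hs.1]) (by linarith [hs.2]), add_sub_cancel]
    exact hwV

lemma exists_ball_prod {E F G : Type*} [PseudoMetricSpace E] [PseudoMetricSpace F]
    [TopologicalSpace G] {f : E × F → G} (hf : Continuous f) {U : Set G} (hU : IsOpen U)
    {x : E} {y : F} (h : f (x, y) ∈ U) :
    ∃ ε > 0, ∀ x' ∈ Metric.ball x ε, ∀ y' ∈ Metric.ball y ε, f (x', y') ∈ U := by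
  obtain ⟨ε, hε, hs⟩ := Metric.isOpen_iff.1 (hU.preimage hf) (x, y) h
  refine ⟨ε, hε, fun x' hx y' hy => hs ?_⟩
  rw [← ball_prod_same]
  exact ⟨hx, hy⟩

lemma TensorProduct.exists_eq_sum_fin {Y : Type*} [NormedAddCommGroup Y] [NormedSpace ℝ Y]
    (z : X ⊗[ℝ] Y) :
    ∃ (n : ℕ) (x : Fin n → X) (y : Fin n → Y), z = ∑ i, x i ⊗ₜ[ℝ] y i := by
  induction z with
  | zero => exact ⟨0, 0, 0, by simp⟩
  | tmul x y => exact ⟨1, fun _ => x, fun _ => y, by simp⟩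
  | add a b ha hb =>
    obtain ⟨n, x, y, rfl⟩ := ha
    obtain ⟨m, x', y', rfl⟩ := hb
    exact ⟨n + m, Fin.append x x', Fin.append y y', by simp [Fin.sum_univ_add]⟩

end Auxiliary

/-- If `T(t)` satisfies the recurrent hypercyclicity criterion and `S(t)` satisfies the
hypercyclicity criterion, then `T(t) ⊗ S(t)` on the completion `X ⊗̃_α Y` satisfies the
hypercyclicity criterion. -/
theorem tensor_product_satisfies_hypercyclicity_criterion
    {X Y : Type*} [NormedAddCommGroup X] [NormedSpace ℝ X] [CompleteSpace X]
    [TopologicalSpace.SeparableSpace X]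
    [NormedAddCommGroup Y] [NormedSpace ℝ Y] [CompleteSpace Y]
    [TopologicalSpace.SeparableSpace Y]
    (T : ℝ → X →L[ℝ] X) (S : ℝ → Y →L[ℝ] Y)
    (hT : IsC0Semigroup T) (hS : IsC0Semigroup S)
    (hTrhc : SatisfiesRHC T) (hShc : SatisfiesHC S)
    (c : UniformCrossNorm X Y)
    -- `Z` together with `j` is the completion `X ⊗̃_α Y` of `(X ⊗ Y, α)`:
    {Z : Type*} [NormedAddCommGroup Z] [NormedSpace ℝ Z] [CompleteSpace Z]
    (j : TensorProduct ℝ X Y →ₗ[ℝ] Z)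
    (hj_isometry : ∀ z, ‖j z‖ = c.α z)
    (hj_dense : DenseRange j)
    -- `A` is the extension of the tensor product semigroup `T(t) ⊗ S(t)` to `Z`:
    (A : ℝ → Z →L[ℝ] Z)
    (hA : ∀ t : ℝ, 0 ≤ t → ∀ z : TensorProduct ℝ X Y,
      A t (j z) = j (TensorProduct.map ((T t : X →ₗ[ℝ] X)) ((S t : Y →ₗ[ℝ] Y)) z)) :
    SatisfiesHC A := by
  rcases subsingleton_or_nontrivial Y with hY | hY
  · have hsub : ∀ z : X ⊗[ℝ] Y, z = 0 := fun z => by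
      obtain ⟨n, x, y, rfl⟩ := z.exists_eq_sum_fin
      simp [fun i => Subsingleton.elim (y i) 0]
    have hmem : ∀ U : Set Z, IsOpen U → U.Nonempty → (0 : Z) ∈ U := fun U hU hUn => by
      obtain ⟨z, hz⟩ := hj_dense.exists_mem_open hU hUn
      rwa [hsub z, map_zero] at hz
    intro U V W hU hV hW hUn hVn h0
    exact ⟨1, one_pos, ⟨0, ⟨0, hmem U hU hUn, map_zero _⟩, h0⟩,
      ⟨0, ⟨0, h0, map_zero _⟩, hmem V hV hVn⟩⟩
  intro U V W hU hV hW hUn hVn h0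
  obtain ⟨zu, hzu⟩ := hj_dense.exists_mem_open hU hUn
  obtain ⟨zv, hzv⟩ := hj_dense.exists_mem_open hV hVn
  obtain ⟨n, x, y, rfl⟩ := zu.exists_eq_sum_fin
  obtain ⟨m, x', y', rfl⟩ := zv.exists_eq_sum_fin
  let B : X →L[ℝ] Y →L[ℝ] Z := ((TensorProduct.mk ℝ X Y).compr₂ j).mkContinuous₂ 1 fun x y => by
    simp [hj_isometry, c.α_cross]
  let F (k : ℕ) (p : (Fin k → X) × (Fin k → Y)) : Z := ∑ i, B (p.1 i) (p.2 i)
  have hF : ∀ k, Continuous (F k) := fun k => by fun_prop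
  have hF0 : ∀ k, F k (0, 0) ∈ W := fun k => by simpa [F] using h0
  have hFj : ∀ k a b, F k (a, b) = j (∑ i, a i ⊗ₜ[ℝ] b i) := fun k a b => by
    rw [map_sum]; rfl
  have hFA : ∀ k t, 0 ≤ t → ∀ a b,
      A t (F k (a, b)) = F k (fun i => T t (a i), fun i => S t (b i)) := fun k t ht a b => by
    simp only [hFj, hA t ht, map_sum, TensorProduct.map_tmul, ContinuousLinearMap.coe_coe]
  rw [← hFj] at hzu hzv
  obtain ⟨ε₁, hε₁, h₁⟩ := exists_ball_prod (hF n) hU hzu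
  obtain ⟨ε₂, hε₂, h₂⟩ := exists_ball_prod (hF m) hV hzv
  obtain ⟨ε₃, hε₃, h₃⟩ := exists_ball_prod (hF n) hW (hF0 n)
  obtain ⟨ε₄, hε₄, h₄⟩ := exists_ball_prod (hF m) hW (hF0 m)
  obtain ⟨ε, hε, hlt⟩ : ∃ ε > 0, ε ≤ ε₁ ∧ ε ≤ ε₂ ∧ ε ≤ ε₃ ∧ ε ≤ ε₄ :=
    ⟨min (min ε₁ ε₂) (min ε₃ ε₄), by positivity, by simp⟩
  obtain ⟨l₁, l₂, l₃, l₄⟩ := hlt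
  obtain ⟨UX, VX, WX, hUX, hVX, hWX, hUXn, hVXn, h0X, hX⟩ :=
    hTrhc.satisfiesHC.exists_approx hT x x' hε
  obtain ⟨UY, VY, WY, hUY, hVY, hWY, hUYn, hVYn, h0Y, hY⟩ := hShc.exists_approx hS y y' hε
  obtain ⟨L, hL, hTL⟩ := hTrhc UX VX WX hUX hVX hWX hUXn hVXn h0X
  obtain ⟨a, ha, hSa⟩ := hShc.exists_Icc hS hL hUY hVY hWY hUYn hVYn h0Y
  obtain ⟨s, hs, hTs⟩ := hTL a ha.le
  have hs0 : 0 < s := ha.trans_le hs.1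
  obtain ⟨⟨p, hp, hTp⟩, w, hw, hTw⟩ := hX s hs0.le hTs.1 hTs.2
  obtain ⟨⟨q, hq, hSq⟩, r, hr, hSr⟩ := hY s hs0.le (hSa s hs).1 (hSa s hs).2
  refine ⟨s, hs0, ⟨_, ⟨F n (p, q), ?_, rfl⟩, ?_⟩, ⟨_, ⟨F m (w, r), ?_, rfl⟩, ?_⟩⟩
  · exact h₁ _ (Metric.ball_subset_ball l₁ hp) _ (Metric.ball_subset_ball l₁ hq)
  · rw [hFA n s hs0.le]
    exact h₃ _ (Metric.ball_subset_ball l₃ hTp) _ (Metric.ball_subset_ball l₃ hSq)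
  · exact h₄ _ (Metric.ball_subset_ball l₄ hw) _ (Metric.ball_subset_ball l₄ hr)
  · rw [hFA m s hs0.le]
    exact h₂ _ (Metric.ball_subset_ball l₂ hTw) _ (Metric.ball_subset_ball l₂ hSr)
end

section
/- Let X and Y be separable Banach spaces, let (T(t))_{t≥0} and (S(t))_{t≥0} be strongly continuous semigroups on X and Y respectively, and let α be a uniform crossnorm on the algebraic tensor product X ⊗ Y. Assume that both T(t) and S(t) satisfy the recurrent hypercyclicity criterion. Then the tensor product semigroup T(t) ⊗ S(t), acting on the completion X ⊗̃_α Y of the normed space (X ⊗ Y, α), satisfies the recurrent hypercyclicity criterion. -/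
open Set Filter Topology TensorProduct

/-- The filter of thickly syndetic subsets of `[0, ∞)`: those which, for every `R`, contain
intervals of length `R` with bounded gaps. -/
def thicklySyndetic : Filter ℝ where
  sets := {P | ∀ R : ℝ, 0 ≤ R → ∃ L : ℝ, 0 ≤ L ∧ ∀ t : ℝ, 0 ≤ t →
    ∃ s ∈ Icc t (t + L), Icc s (s + R) ⊆ P}
  univ_sets := fun _ _ => ⟨0, le_rfl, fun t _ => ⟨t, by simp, subset_univ _⟩⟩
  sets_of_superset := fun hP hPQ R hR => by
    obtain ⟨L, hL, h⟩ := hP R hR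
    refine ⟨L, hL, fun t ht => ?_⟩
    obtain ⟨s, hs, hsP⟩ := h t ht
    exact ⟨s, hs, hsP.trans hPQ⟩
  inter_sets := fun hP hQ R hR => by
    obtain ⟨L₁, hL₁, h₁⟩ := hP R hR
    obtain ⟨L₂, hL₂, h₂⟩ := hQ (L₁ + R) (by positivity)
    refine ⟨L₂ + L₁, by positivity, fun t ht => ?_⟩
    obtain ⟨s, hs, hsQ⟩ := h₂ t ht
    obtain ⟨s', hs', hsP⟩ := h₁ s (ht.trans hs.1)
    refine ⟨s', ⟨hs.1.trans hs'.1, by linarith [hs.2, hs'.2]⟩, subset_inter hsP ?_⟩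
    exact (Icc_subset_Icc hs'.1 (by linarith [hs'.2])).trans hsQ

theorem eventually_thicklySyndetic {p : ℝ → Prop} :
    (∀ᶠ s in thicklySyndetic, p s) ↔ ∀ R : ℝ, 0 ≤ R → ∃ L : ℝ, 0 ≤ L ∧ ∀ t : ℝ, 0 ≤ t →
      ∃ s ∈ Icc t (t + L), ∀ r ∈ Icc s (s + R), p r :=
  Iff.rfl

theorem eventually_thicklySyndetic_nonneg : ∀ᶠ s in thicklySyndetic, 0 ≤ s :=
  eventually_thicklySyndetic.2 fun _ _ =>
    ⟨0, le_rfl, fun t ht => ⟨t, by simp, fun _ hr => ht.trans hr.1⟩⟩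

theorem exists_mem_Icc_of_eventually_thicklySyndetic {p : ℝ → Prop}
    (h : ∀ᶠ s in thicklySyndetic, p s) :
    ∃ L : ℝ, 0 ≤ L ∧ ∀ t : ℝ, 0 ≤ t → ∃ s ∈ Icc t (t + L), p s := by
  obtain ⟨L, hL, hLp⟩ := eventually_thicklySyndetic.1 h 0 le_rfl
  refine ⟨L, hL, fun t ht => ?_⟩
  obtain ⟨s, hs, hsp⟩ := hLp t ht
  exact ⟨s, hs, hsp s (by simp)⟩

/-- The pair `(p, q)` is approximated by pairs `(x, T s x)`, for a thickly syndetic set of times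
`s` depending on the required accuracy. -/
def ApproximatedByGraph {E : Type*} [NormedAddCommGroup E] [NormedSpace ℝ E]
    (T : ℝ → E →L[ℝ] E) (p q : E) : Prop :=
  ∀ U ∈ 𝓝 p, ∀ V ∈ 𝓝 q, ∀ᶠ s in thicklySyndetic, ∃ x ∈ U, T s x ∈ V

section Semigroup

variable {E : Type*} [NormedAddCommGroup E] [NormedSpace ℝ E] {T : ℝ → E →L[ℝ] E}

theorem ApproximatedByGraph.add {p q p' q' : E} (h : ApproximatedByGraph T p q)
    (h' : ApproximatedByGraph T p' q') : ApproximatedByGraph T (p + p') (q + q') := by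
  intro U hU V hV
  obtain ⟨U₁, hU₁, U₂, hU₂, hUU⟩ :=
    mem_nhds_prod_iff.1 ((continuous_add (M := E)).continuousAt (x := (p, p')) hU)
  obtain ⟨V₁, hV₁, V₂, hV₂, hVV⟩ :=
    mem_nhds_prod_iff.1 ((continuous_add (M := E)).continuousAt (x := (q, q')) hV)
  filter_upwards [h U₁ hU₁ V₁ hV₁, h' U₂ hU₂ V₂ hV₂] with s ⟨x, hx, hTx⟩ ⟨y, hy, hTy⟩
  refine ⟨x + y, hUU (mk_mem_prod hx hy), ?_⟩
  rw [map_add]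
  exact hVV (mk_mem_prod hTx hTy)

theorem satisfiesRHC_of_dense {D : Set E} (hD : Dense D)
    (h₁ : ∀ w ∈ D, ApproximatedByGraph T w 0) (h₂ : ∀ w ∈ D, ApproximatedByGraph T 0 w) :
    SatisfiesRHC T := by
  intro U V W hU hV hW hUne hVne hW0
  obtain ⟨u, huU, huD⟩ := hD.inter_open_nonempty U hU hUne
  obtain ⟨v, hvV, hvD⟩ := hD.inter_open_nonempty V hV hVne
  apply exists_mem_Icc_of_eventually_thicklySyndetic
  filter_upwards [h₁ u huD U (hU.mem_nhds huU) W (hW.mem_nhds hW0),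
    h₂ v hvD W (hW.mem_nhds hW0) V (hV.mem_nhds hvV)] with s ⟨x, hx, hTx⟩ ⟨y, hy, hTy⟩
  exact ⟨⟨_, mem_image_of_mem _ hx, hTx⟩, ⟨_, mem_image_of_mem _ hy, hTy⟩⟩

variable [CompleteSpace E]

/-- A strongly continuous semigroup is equicontinuous at `0` on bounded time intervals. -/
theorem IsC0Semigroup.exists_isOpen_forall_mem (hT : IsC0Semigroup T) (R : ℝ) {W : Set E}
    (hW : W ∈ 𝓝 0) :
    ∃ W' : Set E, IsOpen W' ∧ 0 ∈ W' ∧ ∀ r ∈ Icc 0 R, ∀ x ∈ W', T r x ∈ W := by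
  obtain ⟨C, hC⟩ := banach_steinhaus (g := fun r : Icc (0 : ℝ) R => T r) fun x => by
    obtain ⟨C, hC⟩ := isCompact_Icc.exists_bound_of_continuousOn
      ((hT.2.2 x).mono (Icc_subset_Ici_self : Icc 0 R ⊆ Ici 0))
    exact ⟨C, fun r => hC r r.2⟩
  obtain ⟨ε, hε, hεW⟩ := Metric.mem_nhds_iff.1 hW
  have hK : 0 < |C| + 1 := by positivity
  refine ⟨Metric.ball 0 (ε / (|C| + 1)), Metric.isOpen_ball,
    Metric.mem_ball_self (by positivity), fun r hr x hx => hεW ?_⟩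
  rw [mem_ball_zero_iff] at hx ⊢
  calc ‖T r x‖ ≤ (|C| + 1) * ‖x‖ :=
        (T r).le_of_opNorm_le ((hC ⟨r, hr⟩).trans (by linarith [le_abs_self C])) x
    _ < (|C| + 1) * (ε / (|C| + 1)) := by gcongr
    _ = ε := by field_simp

theorem SatisfiesRHC.approximatedByGraph_zero_right (hT : IsC0Semigroup T) (h : SatisfiesRHC T)
    (p : E) : ApproximatedByGraph T p 0 := by
  intro U hU W hW
  refine eventually_thicklySyndetic.2 fun R _ => ?_
  obtain ⟨U', hU'U, hU', hpU'⟩ := mem_nhds_iff.1 hU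
  obtain ⟨W', hW', h0W', hTW⟩ := hT.exists_isOpen_forall_mem R hW
  obtain ⟨L, hL, hLs⟩ := h U' univ W' hU' isOpen_univ hW' ⟨p, hpU'⟩ univ_nonempty h0W'
  refine ⟨L, hL, fun t ht => ?_⟩
  obtain ⟨s, hs, ⟨_, ⟨x, hx, rfl⟩, hxW⟩, -⟩ := hLs t ht
  refine ⟨s, hs, fun r hr => ⟨x, hU'U hx, ?_⟩⟩
  have hrs : T r = (T (r - s)).comp (T s) := by
    rw [← hT.2.1 (r - s) s (sub_nonneg.2 hr.1) (ht.trans hs.1), sub_add_cancel]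
  rw [hrs]
  exact hTW (r - s) ⟨sub_nonneg.2 hr.1, by linarith [hr.2]⟩ _ hxW

theorem SatisfiesRHC.approximatedByGraph_zero_left (hT : IsC0Semigroup T) (h : SatisfiesRHC T)
    (q : E) : ApproximatedByGraph T 0 q := by
  intro W hW V hV
  refine eventually_thicklySyndetic.2 fun R hR => ?_
  obtain ⟨V', hV'V, hV', hqV'⟩ := mem_nhds_iff.1 hV
  obtain ⟨W', hW', h0W', hTW⟩ := hT.exists_isOpen_forall_mem R hW
  obtain ⟨L, hL, hLs⟩ := h univ V' W' isOpen_univ hV' hW' univ_nonempty ⟨q, hqV'⟩ h0W'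
  refine ⟨L, hL, fun t ht => ?_⟩
  obtain ⟨s, hs, -, ⟨_, ⟨x, hx, rfl⟩, hxV⟩⟩ := hLs (t + R) (by positivity)
  refine ⟨s - R, ⟨by linarith [hs.1], by linarith [hs.2]⟩, fun r hr => ?_⟩
  rw [sub_add_cancel] at hr
  have hsr : T s = (T r).comp (T (s - r)) := by
    rw [← hT.2.1 r (s - r) (by linarith [hs.1, hr.1]) (sub_nonneg.2 hr.2), add_sub_cancel]
  refine ⟨T (s - r) x, hTW _ ⟨sub_nonneg.2 hr.2, by linarith [hr.1]⟩ x hx, hV'V ?_⟩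
  rwa [hsr] at hxV

end Semigroup

theorem ApproximatedByGraph.map₂ {X Y Z : Type*} [NormedAddCommGroup X] [NormedSpace ℝ X]
    [NormedAddCommGroup Y] [NormedSpace ℝ Y] [NormedAddCommGroup Z] [NormedSpace ℝ Z]
    {T : ℝ → X →L[ℝ] X} {S : ℝ → Y →L[ℝ] Y} {A : ℝ → Z →L[ℝ] Z} (B : X →L[ℝ] Y →L[ℝ] Z)
    (hA : ∀ t : ℝ, 0 ≤ t → ∀ x y, A t (B x y) = B (T t x) (S t y)) {p q : X} {p' q' : Y}
    (h : ApproximatedByGraph T p q) (h' : ApproximatedByGraph S p' q') :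
    ApproximatedByGraph A (B p p') (B q q') := by
  intro U hU V hV
  obtain ⟨U₁, hU₁, U₂, hU₂, hUU⟩ :=
    mem_nhds_prod_iff.1 (B.continuous₂.continuousAt (x := (p, p')) hU)
  obtain ⟨V₁, hV₁, V₂, hV₂, hVV⟩ :=
    mem_nhds_prod_iff.1 (B.continuous₂.continuousAt (x := (q, q')) hV)
  filter_upwards [h U₁ hU₁ V₁ hV₁, h' U₂ hU₂ V₂ hV₂, eventually_thicklySyndetic_nonneg]
    with s ⟨x, hx, hTx⟩ ⟨y, hy, hSy⟩ hs
  refine ⟨B x y, hUU (mk_mem_prod hx hy), ?_⟩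
  rw [hA s hs]
  exact hVV (mk_mem_prod hTx hSy)

/-- If both `T(t)` and `S(t)` satisfy the recurrent hypercyclicity criterion, then so does
`T(t) ⊗ S(t)` on the completion `X ⊗̃_α Y`. -/
theorem tensor_product_satisfies_recurrent_hypercyclicity_criterion
    {X Y : Type*} [NormedAddCommGroup X] [NormedSpace ℝ X] [CompleteSpace X]
    [TopologicalSpace.SeparableSpace X]
    [NormedAddCommGroup Y] [NormedSpace ℝ Y] [CompleteSpace Y]
    [TopologicalSpace.SeparableSpace Y]
    (T : ℝ → X →L[ℝ] X) (S : ℝ → Y →L[ℝ] Y)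
    (hT : IsC0Semigroup T) (hS : IsC0Semigroup S)
    (hTrhc : SatisfiesRHC T) (hSrhc : SatisfiesRHC S)
    (c : UniformCrossNorm X Y)
    -- `Z` together with `j` is the completion `X ⊗̃_α Y` of `(X ⊗ Y, α)`:
    {Z : Type*} [NormedAddCommGroup Z] [NormedSpace ℝ Z] [CompleteSpace Z]
    (j : TensorProduct ℝ X Y →ₗ[ℝ] Z)
    (hj_isometry : ∀ z, ‖j z‖ = c.α z)
    (hj_dense : DenseRange j)
    -- `A` is the extension of the tensor product semigroup `T(t) ⊗ S(t)` to `Z`: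
    (A : ℝ → Z →L[ℝ] Z)
    (hA : ∀ t : ℝ, 0 ≤ t → ∀ z : TensorProduct ℝ X Y,
      A t (j z) = j (TensorProduct.map ((T t : X →ₗ[ℝ] X)) ((S t : Y →ₗ[ℝ] Y)) z)) :
    SatisfiesRHC A := by
  let B : X →L[ℝ] Y →L[ℝ] Z :=
    ((TensorProduct.mk ℝ X Y).compr₂ j).mkContinuous₂ 1 fun x y => by
      simp [hj_isometry, c.α_cross]
  have hB : ∀ x y, B x y = j (x ⊗ₜ[ℝ] y) := fun _ _ => rfl
  have hAB : ∀ t : ℝ, 0 ≤ t → ∀ x y, A t (B x y) = B (T t x) (S t y) := fun t ht x y => by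
    simp [hB, hA t ht]
  have h₁ (w : X ⊗[ℝ] Y) : ApproximatedByGraph A (j w) 0 := by
    have htmul (x : X) (y : Y) : ApproximatedByGraph A (j (x ⊗ₜ[ℝ] y)) 0 := by
      simpa [hB] using (hTrhc.approximatedByGraph_zero_right hT x).map₂ B hAB
        (hSrhc.approximatedByGraph_zero_right hS y)
    induction w using TensorProduct.induction_on with
    | zero => simpa using htmul 0 0
    | tmul x y => exact htmul x y
    | add v w hv hw => simpa using hv.add hw
  have h₂ (w : X ⊗[ℝ] Y) : ApproximatedByGraph A 0 (j w) := by
    induction w using TensorProduct.induction_on with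
    | zero => simpa using h₁ 0
    | tmul x y =>
      simpa [hB] using (hTrhc.approximatedByGraph_zero_left hT x).map₂ B hAB
        (hSrhc.approximatedByGraph_zero_left hS y)
    | add v w hv hw => simpa using hv.add hw
  exact satisfiesRHC_of_dense hj_dense (forall_mem_range.2 h₁) (forall_mem_range.2 h₂)
end

section
/- Let X and Y be separable Banach spaces, let (T(t))_{t≥0} and (S(t))_{t≥0} be chaotic strongly continuous semigroups on X and Y respectively, and let α be a uniform crossnorm on the algebraic tensor product X ⊗ Y. Then the tensor product semigroup T(t) ⊗ S(t), acting on the completion X ⊗̃_α Y of the normed space (X ⊗ Y, α), satisfies the recurrent hypercyclicity criterion. -/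
open Set Filter Topology TensorProduct

section RecurrentHypercyclicity

variable {X : Type*} [NormedAddCommGroup X] [NormedSpace ℝ X] {T : ℝ → X →L[ℝ] X}

/-- The set of times `t ≥ 0` at which some point of `U` is mapped into `V`. -/
def returnTimes (T : ℝ → X →L[ℝ] X) (U V : Set X) : Set ℝ :=
  {t | 0 ≤ t ∧ ∃ x ∈ U, T t x ∈ V}

/-- The set of periodic points of a semigroup. -/
def periodicPoints (T : ℝ → X →L[ℝ] X) : Set X :=
  {x | ∃ t : ℝ, 0 < t ∧ T t x = x}

lemma IsC0Semigroup.apply_nat_mul (hT : IsC0Semigroup T) {τ : ℝ} (hτ : 0 ≤ τ) {x : X}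
    (hx : T τ x = x) (k : ℕ) : T (k * τ) x = x := by
  induction k with
  | zero => simp [hT.1]
  | succ k ih =>
    have : ((k + 1 : ℕ) : ℝ) * τ = k * τ + τ := by push_cast; ring
    rw [this, hT.add_apply (by positivity) hτ, hx, ih]

lemma IsC0Semigroup.exists_bound_orbit (hT : IsC0Semigroup T) {x : X}
    (hx : x ∈ periodicPoints T) : ∃ C : ℝ, 0 ≤ C ∧ ∀ s : ℝ, 0 ≤ s → ‖T s x‖ ≤ C := by
  obtain ⟨τ, hτ, hx⟩ := hx
  obtain ⟨C, hC⟩ := (isCompact_Icc (a := (0 : ℝ)) (b := τ)).exists_bound_of_continuousOn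
    ((hT.2.2 x).mono Icc_subset_Ici_self)
  refine ⟨C, (norm_nonneg _).trans (hC 0 ⟨le_rfl, hτ.le⟩), fun s hs => ?_⟩
  have h1 : (⌊s / τ⌋₊ : ℝ) * τ ≤ s := (le_div_iff₀ hτ).1 (Nat.floor_le (by positivity))
  have h2 : s < (⌊s / τ⌋₊ + 1 : ℝ) * τ := (div_lt_iff₀ hτ).1 (Nat.lt_floor_add_one _)
  have h3 : T s x = T (s - ⌊s / τ⌋₊ * τ) x := by
    conv_lhs => rw [← sub_add_cancel s (⌊s / τ⌋₊ * τ)]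
    rw [hT.add_apply (by linarith) (by positivity), hT.apply_nat_mul hτ.le hx]
  rw [h3]
  exact hC _ ⟨by linarith, by linarith⟩

/-- A periodic point can be reached from a point of its orbit in any prescribed time. -/
lemma IsC0Semigroup.exists_preimage_of_periodic (hT : IsC0Semigroup T) {x : X}
    (hx : x ∈ periodicPoints T) {s : ℝ} (hs : 0 ≤ s) :
    ∃ r : ℝ, 0 ≤ r ∧ T s (T r x) = x ∧ T r (T s x) = x := by
  obtain ⟨τ, hτ, hx⟩ := hx
  have h : s ≤ ⌈s / τ⌉₊ * τ := (div_le_iff₀ hτ).1 (Nat.le_ceil _)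
  refine ⟨⌈s / τ⌉₊ * τ - s, by linarith, ?_, ?_⟩
  · rw [← hT.add_apply hs (by linarith), add_sub_cancel, hT.apply_nat_mul hτ.le hx]
  · rw [← hT.add_apply (by linarith) hs, sub_add_cancel, hT.apply_nat_mul hτ.le hx]

/-- Finitely many real rotations are simultaneously almost trivial at a relatively dense set of
times. -/
lemma exists_relativelyDense_abs_sub_round_lt {ι : Type*} [Finite ι] (τ : ι → ℝ) {δ : ℝ}
    (hδ : 0 < δ) : ∃ L : ℝ, 0 ≤ L ∧ ∀ a : ℝ, ∃ s ∈ Icc a (a + L),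
      ∀ i, |s / τ i - round (s / τ i)| < δ := by
  have := Fintype.ofFinite ι
  let f : ℝ → ι → UnitAddCircle := fun t i => ((t / τ i : ℝ) : UnitAddCircle)
  obtain ⟨t, ht, htf, hcov⟩ := Metric.finite_approx_of_totallyBounded
    (isCompact_univ.totallyBounded.subset (subset_univ (range f))) δ hδ
  obtain ⟨F, -, hF, rfl⟩ : ∃ F ⊆ univ, F.Finite ∧ t = f '' F :=
    exists_subset_image_finite_and.1 ⟨t, image_univ ▸ ht, htf, rfl⟩
  obtain ⟨M, hM⟩ := hF.isBounded.exists_norm_le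
  refine ⟨2 * |M|, by positivity, fun a => ?_⟩
  obtain ⟨_, ⟨b, hb, rfl⟩, hab⟩ := mem_iUnion₂.1 (hcov (mem_range_self (a + |M|)))
  have hbM : |b| ≤ |M| := (hM b hb).trans (le_abs_self M)
  refine ⟨a + |M| - b, ⟨by linarith [le_abs_self b], by linarith [neg_abs_le b]⟩, fun i => ?_⟩
  have h := (dist_pi_lt_iff hδ).1 (Metric.mem_ball.1 hab) i
  rw [dist_eq_norm] at h
  have h' : f (a + |M|) i - f b i = (((a + |M| - b) / τ i : ℝ) : UnitAddCircle) := by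
    simp only [f]
    rw [← AddCircle.coe_sub, sub_div]
  rwa [h', UnitAddCircle.norm_eq] at h

lemma IsC0Semigroup.eventually_mem_of_periodic (hT : IsC0Semigroup T) {x : X} {τ : ℝ} (hτ : 0 < τ)
    (hx : T τ x = x) {O : Set X} (hO : IsOpen O) (hxO : x ∈ O) :
    ∀ᶠ δ : ℝ in 𝓝[>] 0, ∀ s, 0 ≤ s → |s / τ - round (s / τ)| < δ → T s x ∈ O := by
  have hcont : ContinuousAt (fun t => T t x) τ := (hT.2.2 x).continuousAt (Ici_mem_nhds hτ)
  have hev : ∀ᶠ t in 𝓝 τ, T t x ∈ O ∧ 0 ≤ t :=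
    (hcont.eventually (hO.mem_nhds (by simpa only [hx] using hxO))).and (Ici_mem_nhds hτ)
  obtain ⟨η, hη, h⟩ := Metric.eventually_nhds_iff.1 hev
  filter_upwards [Ioo_mem_nhdsGT (show 0 < η / τ by positivity)] with δ hδ s hs hround
  obtain ⟨k, hk⟩ := Int.eq_ofNat_of_zero_le (show 0 ≤ round (s / τ) by
    rw [round_eq]; exact Int.floor_nonneg.2 (by positivity))
  rw [hk] at hround
  simp only [Int.cast_natCast] at hround
  have hr : dist (s - k * τ + τ) τ < η := by
    have h1 : s - k * τ = (s / τ - k) * τ := by field_simp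
    rw [Real.dist_eq, add_sub_cancel_right, h1, abs_mul, abs_of_pos hτ]
    exact (lt_div_iff₀ hτ).1 (hround.trans hδ.2)
  have h2 := h hr
  have h3 : T s x = T (s - k * τ + τ) x := by
    calc T s x = T (s + τ) x := by rw [hT.add_apply hs hτ.le, hx]
      _ = T (s - k * τ + τ + k * τ) x := by congr 2; ring
      _ = _ := by rw [hT.add_apply h2.2 (by positivity), hT.apply_nat_mul hτ.le hx]
  rw [h3]
  exact h2.1

/-- Common return times of finitely many pairs of open sets, if there are any, are relatively
dense. -/
lemma IsC0Semigroup.relativelyDense_returnTimes (hT : IsC0Semigroup T)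
    (hper : Dense (periodicPoints T)) {ι : Type*} [Finite ι] {U V : ι → Set X}
    (hU : ∀ i, IsOpen (U i)) (hV : ∀ i, IsOpen (V i)) {t : ℝ} (ht0 : 0 ≤ t)
    (ht : ∀ i, t ∈ returnTimes T (U i) (V i)) :
    ∃ L : ℝ, 0 ≤ L ∧ ∀ a : ℝ, 0 ≤ a → ∃ s ∈ Icc a (a + L),
      ∀ i, s ∈ returnTimes T (U i) (V i) := by
  have hO : ∀ i, IsOpen (T t ⁻¹' V i) := fun i => (hV i).preimage (T t).continuous
  have hex : ∀ i, ∃ u ∈ U i ∩ T t ⁻¹' V i, u ∈ periodicPoints T := fun i => by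
    obtain ⟨-, x, hx, hxV⟩ := ht i
    exact hper.inter_open_nonempty _ ((hU i).inter (hO i)) ⟨x, hx, hxV⟩
  choose u hu τ hτ hτu using hex
  obtain ⟨δ, hδ, hδ0⟩ := ((eventually_all.2 fun i =>
    hT.eventually_mem_of_periodic (hτ i) (hτu i) (hO i) (hu i).2).and self_mem_nhdsWithin).exists
  obtain ⟨L, hL, h⟩ := exists_relativelyDense_abs_sub_round_lt τ (mem_Ioi.1 hδ0)
  refine ⟨t + L, by linarith, fun a ha => ?_⟩
  obtain ⟨s, hs, hsr⟩ := h a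
  have hs0 : 0 ≤ s := ha.trans hs.1
  refine ⟨t + s, ⟨by linarith [hs.1], by linarith [hs.2]⟩, fun i =>
    ⟨by linarith, u i, (hu i).1, ?_⟩⟩
  rw [hT.add_apply ht0 hs0]
  exact hδ i s hs0 (hsr i)

lemma IsChaoticSg.returnTimes_nonempty (hT : IsC0Semigroup T) (hc : IsChaoticSg T) {U V : Set X}
    (hU : IsOpen U) (hV : IsOpen V) (hUn : U.Nonempty) (hVn : V.Nonempty) :
    (returnTimes T U V).Nonempty := by
  obtain ⟨⟨x, hx⟩, hper⟩ := hc
  obtain ⟨_, hsU, s, hs, rfl⟩ := hx.inter_open_nonempty U hU hUn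
  obtain ⟨_, hrV, r, hr, rfl⟩ := hx.inter_open_nonempty V hV hVn
  rcases le_total s r with hsr | hrs
  · refine ⟨r - s, by linarith, T s x, hsU, ?_⟩
    rwa [← hT.add_apply (by linarith) hs, sub_add_cancel]
  · obtain ⟨p, ⟨hpV, hpU⟩, hp⟩ := hper.inter_open_nonempty (V ∩ T (s - r) ⁻¹' U)
      (hV.inter (hU.preimage (T (s - r)).continuous)) ⟨T r x, hrV, by
        rwa [mem_preimage, ← hT.add_apply (by linarith) hr, sub_add_cancel]⟩
    obtain ⟨q, hq, -, hqp⟩ := hT.exists_preimage_of_periodic hp (sub_nonneg.2 hrs)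
    exact ⟨q, hq, _, hpU, by rwa [hqp]⟩

/-- `C₀`-semigroups are locally equicontinuous. -/
lemma IsC0Semigroup.exists_ball_mapsTo [CompleteSpace X] (hT : IsC0Semigroup T) (L : ℝ) {ε : ℝ}
    (hε : 0 < ε) : ∃ η > 0, ∀ t ∈ Icc 0 L,
      MapsTo (T t) (Metric.ball 0 η) (Metric.ball 0 ε) := by
  obtain ⟨C, hC⟩ := banach_steinhaus (g := fun t : Icc (0 : ℝ) L => T t) fun x => by
    obtain ⟨C, hC⟩ := (isCompact_Icc (a := (0 : ℝ)) (b := L)).exists_bound_of_continuousOn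
      ((hT.2.2 x).mono Icc_subset_Ici_self)
    exact ⟨C, fun t => hC t t.2⟩
  have hpos : 0 < |C| + 1 := by positivity
  refine ⟨ε / (|C| + 1), by positivity, fun t ht x hx => ?_⟩
  rw [mem_ball_zero_iff] at hx ⊢
  calc ‖T t x‖ ≤ ‖T t‖ * ‖x‖ := (T t).le_opNorm x
    _ ≤ (|C| + 1) * ‖x‖ := by
      gcongr
      linarith [hC ⟨t, ht⟩, le_abs_self C]
    _ < ε := by rwa [lt_div_iff₀' hpos] at hx

/-- A set of times is thick if it contains arbitrarily long intervals. -/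
def IsThickTimes (N : Set ℝ) : Prop :=
  ∀ L : ℝ, 0 ≤ L → ∃ a, 0 ≤ a ∧ Icc a (a + L) ⊆ N

lemma IsChaoticSg.isThickTimes_returnTimes_ball_right [CompleteSpace X] (hT : IsC0Semigroup T)
    (hc : IsChaoticSg T) {U : Set X} (hU : IsOpen U) (hUn : U.Nonempty) {ε : ℝ} (hε : 0 < ε) :
    IsThickTimes (returnTimes T U (Metric.ball 0 ε)) := by
  intro L _
  obtain ⟨η, hη, h⟩ := hT.exists_ball_mapsTo L hε
  obtain ⟨a, ha, x, hx, hxa⟩ := hc.returnTimes_nonempty hT hU Metric.isOpen_ball hUn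
    ⟨0, Metric.mem_ball_self hη⟩
  refine ⟨a, ha, fun t ht => ⟨ha.trans ht.1, x, hx, ?_⟩⟩
  rw [← sub_add_cancel t a, hT.add_apply (sub_nonneg.2 ht.1) ha]
  exact h _ ⟨sub_nonneg.2 ht.1, by linarith [ht.2]⟩ hxa

lemma IsChaoticSg.isThickTimes_returnTimes_ball_left [CompleteSpace X] (hT : IsC0Semigroup T)
    (hc : IsChaoticSg T) {V : Set X} (hV : IsOpen V) (hVn : V.Nonempty) {ε : ℝ} (hε : 0 < ε) :
    IsThickTimes (returnTimes T (Metric.ball 0 ε) V) := by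
  intro L hL
  obtain ⟨η, hη, h⟩ := hT.exists_ball_mapsTo L hε
  obtain ⟨b, hb⟩ := hc.returnTimes_nonempty hT Metric.isOpen_ball hV
    ⟨0, Metric.mem_ball_self hη⟩ hVn
  obtain ⟨M, -, hM⟩ := hT.relativelyDense_returnTimes hc.2 (ι := Unit)
    (fun _ => Metric.isOpen_ball) (fun _ => hV) hb.1 (fun _ => hb)
  obtain ⟨r, ⟨hLr, -⟩, hr⟩ := hM L hL
  obtain ⟨hr0, x, hx, hxV⟩ := hr ()
  refine ⟨r - L, by linarith, fun t ht => ?_⟩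
  have ht0 : 0 ≤ t := by linarith [ht.1]
  have htr : 0 ≤ r - t := by linarith [ht.2]
  refine ⟨ht0, T (r - t) x, h _ ⟨htr, by linarith [ht.1]⟩ hx, ?_⟩
  rwa [← hT.add_apply ht0 htr, add_sub_cancel]

/-- Finitely many pairs of open sets with thick sets of return times have common return times. -/
lemma IsC0Semigroup.relativelyDense_returnTimes_of_isThickTimes (hT : IsC0Semigroup T)
    (hper : Dense (periodicPoints T)) {ι : Type*} [Finite ι] {U V : ι → Set X}
    (hU : ∀ i, IsOpen (U i)) (hV : ∀ i, IsOpen (V i))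
    (hthick : ∀ i, IsThickTimes (returnTimes T (U i) (V i))) :
    ∃ L : ℝ, 0 ≤ L ∧ ∀ a : ℝ, 0 ≤ a → ∃ s ∈ Icc a (a + L),
      ∀ i, s ∈ returnTimes T (U i) (V i) := by
  classical
  have := Fintype.ofFinite ι
  have key : ∀ F : Finset ι, ∃ t : ℝ, 0 ≤ t ∧ ∀ i ∈ F, t ∈ returnTimes T (U i) (V i) := by
    intro F
    induction F using Finset.induction_on with
    | empty => exact ⟨0, le_rfl, by simp⟩
    | insert k F _ ih =>
      obtain ⟨t, ht0, ht⟩ := ih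
      obtain ⟨L, hL, h⟩ := hT.relativelyDense_returnTimes hper (ι := F)
        (fun i => hU i) (fun i => hV i) ht0 (fun i => ht i i.2)
      obtain ⟨a, ha, hsub⟩ := hthick k L hL
      obtain ⟨s, hs, hsF⟩ := h a ha
      refine ⟨s, ha.trans hs.1, fun i hi => ?_⟩
      rcases Finset.mem_insert.1 hi with rfl | hi
      · exact hsub hs
      · exact hsF ⟨i, hi⟩
  obtain ⟨t, ht0, ht⟩ := key Finset.univ
  exact hT.relativelyDense_returnTimes hper hU hV ht0 fun i => ht i (Finset.mem_univ i)

/-- Sums of values of a bounded bilinear map are small if one factor is small and the other one is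
bounded. -/
lemma exists_pos_sum_bilinear_mem {Y Z ι : Type*} [NormedAddCommGroup Y] [NormedSpace ℝ Y]
    [NormedAddCommGroup Z] [NormedSpace ℝ Z] [Fintype ι] (B : X →L[ℝ] Y →L[ℝ] Z) {W : Set Z}
    (hW : W ∈ 𝓝 (0 : Z)) {C : ι → ℝ} (hC : ∀ i, 0 ≤ C i) :
    ∃ δ > 0, ∀ (x : ι → X) (y : ι → Y), (∀ i, x i ∈ Metric.ball 0 δ) → (∀ i, ‖y i‖ ≤ C i) →
      ∑ i, B (x i) (y i) ∈ W := by
  obtain ⟨ε, hε, hεW⟩ := Metric.mem_nhds_iff.1 hW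
  have hsum : 0 ≤ ∑ i, ‖B‖ * C i := Finset.sum_nonneg fun i _ => mul_nonneg (norm_nonneg B) (hC i)
  have hpos : 0 < ∑ i, ‖B‖ * C i + 1 := by linarith
  set D := ∑ i, ‖B‖ * C i with hD
  refine ⟨ε / (D + 1), by positivity, fun x y hx hy => hεW ?_⟩
  rw [mem_ball_zero_iff]
  calc ‖∑ i, B (x i) (y i)‖ ≤ ∑ i, ε / (D + 1) * (‖B‖ * C i) := by
        refine norm_sum_le_of_le _ fun i _ => ?_
        have hxi : ‖x i‖ ≤ ε / (D + 1) := (mem_ball_zero_iff.1 (hx i)).le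
        calc ‖B (x i) (y i)‖ ≤ ‖B‖ * ‖x i‖ * ‖y i‖ := B.le_opNorm₂ _ _
          _ ≤ ‖B‖ * (ε / (D + 1)) * C i := by
            gcongr
            exact hy i
          _ = _ := by ring
    _ = ε * (D / (D + 1)) := by rw [← Finset.mul_sum, ← hD]; ring
    _ < ε * 1 := by
        gcongr
        rw [div_lt_one hpos]; linarith
    _ = ε := mul_one ε

/-- A nonempty open set contains a finite sum `∑ B xᵢ yᵢ` with all `yᵢ` in a given dense set, and
it still contains the sum after small perturbations of the `xᵢ`. -/
lemma exists_sum_bilinear_mem_of_dense {Y Z : Type*} [NormedAddCommGroup Y] [NormedSpace ℝ Y]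
    [NormedAddCommGroup Z] [NormedSpace ℝ Z] (B : X →L[ℝ] Y →L[ℝ] Z) {j : X ⊗[ℝ] Y →ₗ[ℝ] Z}
    (hB : ∀ x y, B x y = j (x ⊗ₜ y)) (hj : DenseRange j) {P : Set Y} (hP : Dense P) {U : Set Z}
    (hU : IsOpen U) (hUn : U.Nonempty) :
    ∃ (n : ℕ) (x : Fin n → X) (y : Fin n → Y), (∀ i, y i ∈ P) ∧ ∃ δ > 0, ∀ x' : Fin n → X,
      (∀ i, x' i ∈ Metric.ball (x i) δ) → ∑ i, B (x' i) (y i) ∈ U := by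
  obtain ⟨z, hz⟩ := hj.exists_mem_open hU hUn
  obtain ⟨n, x, y₀, rfl⟩ : ∃ (n : ℕ) (x : Fin n → X) (y : Fin n → Y),
      z = ∑ i, x i ⊗ₜ[ℝ] y i := by
    obtain ⟨F, rfl⟩ := TensorProduct.exists_finset z
    refine ⟨F.card, fun i => (F.equivFin.symm i).1.1, fun i => (F.equivFin.symm i).1.2, ?_⟩
    rw [← Finset.sum_coe_sort F]
    exact (Equiv.sum_comp F.equivFin.symm fun p => p.1.1 ⊗ₜ[ℝ] p.1.2).symm
  have hcy : Continuous fun y : Fin n → Y => ∑ i, B (x i) (y i) := by fun_prop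
  obtain ⟨y, hyU, hyP⟩ := (dense_pi univ fun (_ : Fin n) _ => hP).inter_open_nonempty _
    (hU.preimage hcy) ⟨y₀, by simpa [hB] using hz⟩
  have hcx : Continuous fun x : Fin n → X => ∑ i, B (x i) (y i) := by fun_prop
  obtain ⟨δ, hδ, h⟩ := Metric.isOpen_iff.1 (hU.preimage hcx) x hyU
  exact ⟨n, x, y, fun i => hyP i (mem_univ i), δ, hδ, fun x' hx' =>
    h (Metric.mem_ball.2 ((dist_pi_lt_iff hδ).2 hx'))⟩

end RecurrentHypercyclicity

/-- If `T(t)` and `S(t)` are chaotic semigroups, then `T(t) ⊗ S(t)` on the completion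
`X ⊗̃_α Y` satisfies the recurrent hypercyclicity criterion. -/
theorem tensor_product_of_chaotic_satisfies_rhc
    {X Y : Type*} [NormedAddCommGroup X] [NormedSpace ℝ X] [CompleteSpace X]
    [TopologicalSpace.SeparableSpace X]
    [NormedAddCommGroup Y] [NormedSpace ℝ Y] [CompleteSpace Y]
    [TopologicalSpace.SeparableSpace Y]
    (T : ℝ → X →L[ℝ] X) (S : ℝ → Y →L[ℝ] Y)
    (hT : IsC0Semigroup T) (hS : IsC0Semigroup S)
    (hTchaotic : IsChaoticSg T) (hSchaotic : IsChaoticSg S)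
    (c : UniformCrossNorm X Y)
    -- `Z` together with `j` is the completion `X ⊗̃_α Y` of `(X ⊗ Y, α)`:
    {Z : Type*} [NormedAddCommGroup Z] [NormedSpace ℝ Z] [CompleteSpace Z]
    (j : TensorProduct ℝ X Y →ₗ[ℝ] Z)
    (hj_isometry : ∀ z, ‖j z‖ = c.α z)
    (hj_dense : DenseRange j)
    -- `A` is the extension of the tensor product semigroup `T(t) ⊗ S(t)` to `Z`:
    (A : ℝ → Z →L[ℝ] Z)
    (hA : ∀ t : ℝ, 0 ≤ t → ∀ z : TensorProduct ℝ X Y,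
      A t (j z) = j (TensorProduct.map ((T t : X →ₗ[ℝ] X)) ((S t : Y →ₗ[ℝ] Y)) z)) :
    SatisfiesRHC A := by
  let B : X →L[ℝ] Y →L[ℝ] Z := LinearMap.mkContinuous₂ ((TensorProduct.mk ℝ X Y).compr₂ j) 1
    fun x y => by simp [hj_isometry, c.α_cross]
  have hB : ∀ x y, B x y = j (x ⊗ₜ y) := fun x y => rfl
  have hAB : ∀ t : ℝ, 0 ≤ t → ∀ x y, A t (B x y) = B (T t x) (S t y) := fun t ht x y => by
    simp [hB, hA t ht]
  intro U V W hU hV hW hUn hVn h0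
  have hWn : W ∈ 𝓝 (0 : Z) := hW.mem_nhds h0
  have hP : Dense (periodicPoints S) := hSchaotic.2
  obtain ⟨m, x, y, hy, δ₁, hδ₁, hxU⟩ := exists_sum_bilinear_mem_of_dense B hB hj_dense hP hU hUn
  obtain ⟨n, x', y', hy', δ₂, hδ₂, hxV⟩ := exists_sum_bilinear_mem_of_dense B hB hj_dense hP hV hVn
  choose C hC0 hC using fun i => hS.exists_bound_orbit (hy i)
  choose C' hC0' hC' using fun i => hS.exists_bound_orbit (hy' i)
  obtain ⟨ε₁, hε₁, hW₁⟩ := exists_pos_sum_bilinear_mem B hWn hC0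
  obtain ⟨ε₂, hε₂, hW₂⟩ := exists_pos_sum_bilinear_mem B hWn hC0'
  obtain ⟨L, hL, h⟩ := hT.relativelyDense_returnTimes_of_isThickTimes hTchaotic.2
    (ι := Fin m ⊕ Fin n)
    (U := Sum.elim (fun i => Metric.ball (x i) δ₁) fun _ => Metric.ball 0 ε₂)
    (V := Sum.elim (fun _ => Metric.ball 0 ε₁) fun i => Metric.ball (x' i) δ₂)
    (by rintro (i | i) <;> exact Metric.isOpen_ball)
    (by rintro (i | i) <;> exact Metric.isOpen_ball)
    (by
      rintro (i | i)
      · exact hTchaotic.isThickTimes_returnTimes_ball_right hT Metric.isOpen_ball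
          ⟨x i, Metric.mem_ball_self hδ₁⟩ hε₁
      · exact hTchaotic.isThickTimes_returnTimes_ball_left hT Metric.isOpen_ball
          ⟨x' i, Metric.mem_ball_self hδ₂⟩ hε₂)
  refine ⟨L, hL, fun t ht => ?_⟩
  obtain ⟨s, hs, hret⟩ := h t ht
  have hs0 : 0 ≤ s := ht.trans hs.1
  choose u hu hTu using fun i => (hret (Sum.inl i)).2
  choose v hv hTv using fun i => (hret (Sum.inr i)).2
  choose r hr hSr _ using fun i => hS.exists_preimage_of_periodic (hy' i) hs0
  refine ⟨s, hs, ⟨A s (∑ i, B (u i) (y i)), mem_image_of_mem _ (hxU u hu), ?_⟩,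
    ⟨A s (∑ i, B (v i) (S (r i) (y' i))), mem_image_of_mem _ (hW₂ v _ hv fun i => hC' i _ (hr i)),
      ?_⟩⟩
  · simp only [map_sum, hAB s hs0]
    exact hW₁ _ _ hTu fun i => hC i s hs0
  · simp only [map_sum, hAB s hs0, hSr]
    exact hxV _ hTv
end

section
/- Let X and Y be separable Banach spaces, let (T(t))_{t≥0} and (S(t))_{t≥0} be strongly continuous semigroups on X and Y respectively, and let α be a uniform crossnorm on the algebraic tensor product X ⊗ Y. If there exists t₀ > 0 such that the bounded operator T(t₀) is a chaotic operator on X and the set of periodic points of the operator S(t₀) is dense in Y, then the tensor product semigroup T(t) ⊗ S(t) on the completion X ⊗̃_α Y is a chaotic semigroup. -/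
open Set Filter Topology TensorProduct

/-- A bounded operator is chaotic: some orbit under its iterates is dense, and the
set of its periodic points is dense. -/
def IsChaoticOp {X : Type*} [NormedAddCommGroup X] [NormedSpace ℝ X]
    (T : X →L[ℝ] X) : Prop :=
  (∃ x : X, Dense {y : X | ∃ n : ℕ, (T ^ n) x = y}) ∧
  Dense {x : X | ∃ n : ℕ, 1 ≤ n ∧ (T ^ n) x = x}

/-- If `u` has a dense orbit and `T` has dense periodic points, every neighbourhood of `u` contains
a periodic point whose orbit visits a given neighbourhood of `0`. -/
lemma exists_periodic_mem_pow_mem {X : Type*} [NormedAddCommGroup X] [NormedSpace ℝ X]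
    {T : X →L[ℝ] X} {u : X} (hu : Dense {y : X | ∃ n : ℕ, (T ^ n) u = y})
    (hper : Dense {x : X | ∃ n : ℕ, 1 ≤ n ∧ (T ^ n) x = x})
    {U W : Set X} (hU : U ∈ 𝓝 u) (hW : W ∈ 𝓝 (0 : X)) :
    ∃ (n p : ℕ) (a : X), 1 ≤ p ∧ a ∈ U ∧ (T ^ p) a = a ∧ (T ^ n) a ∈ W := by
  obtain ⟨_, hnW, n, rfl⟩ := mem_closure_iff_nhds.1 (hu 0) _ (interior_mem_nhds.2 hW)
  have hpre : (T ^ n) ⁻¹' W ∈ 𝓝 u :=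
    (T ^ n).continuous.continuousAt.preimage_mem_nhds (mem_interior_iff_mem_nhds.1 hnW)
  obtain ⟨a, ⟨haU, haW⟩, p, hp, hpa⟩ := mem_closure_iff_nhds.1 (hper u) _ (inter_mem hU hpre)
  exact ⟨n, p, a, hp, haU, hpa, haW⟩

/-- Finitely many powers of `T` map some neighbourhood of `0` into a given one. -/
lemma exists_nhds_zero_pow_mem {X : Type*} [NormedAddCommGroup X] [NormedSpace ℝ X]
    (T : X →L[ℝ] X) {W : Set X} (hW : W ∈ 𝓝 (0 : X)) (M : ℕ) :
    ∃ W' ∈ 𝓝 (0 : X), ∀ j ≤ M, ∀ w ∈ W', (T ^ j) w ∈ W := by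
  refine ⟨⋂ j ∈ Iic M, (T ^ j) ⁻¹' W, (Filter.biInter_mem (finite_Iic M)).2 fun j _ => ?_,
    fun j hj w hw => mem_iInter₂.1 hw j hj⟩
  exact (T ^ j).continuous.continuousAt.preimage_mem_nhds (by simpa using hW)

lemma pow_mul_apply_of_pow_apply {X : Type*} [NormedAddCommGroup X] [NormedSpace ℝ X]
    {T : X →L[ℝ] X} {a : X} {p : ℕ} (h : (T ^ p) a = a) (k : ℕ) : (T ^ (p * k)) a = a := by
  induction k with
  | zero => simp
  | succ k ih => rw [Nat.mul_succ, pow_add, mul_apply_eq_comp, h, ih]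

/-- A form of the hypercyclicity criterion along multiples of `N`, for operators having a vector
with dense orbit and dense periodic points. -/
lemma exists_pow_mul_mem_nhds {X : Type*} [NormedAddCommGroup X] [NormedSpace ℝ X]
    {T : X →L[ℝ] X} {u : X} (hu : Dense {y : X | ∃ n : ℕ, (T ^ n) u = y})
    (hper : Dense {x : X | ∃ n : ℕ, 1 ≤ n ∧ (T ^ n) x = x}) {N : ℕ} (hN : 1 ≤ N)
    {U W : Set X} (hU : U ∈ 𝓝 u) (hW : W ∈ 𝓝 (0 : X)) :
    ∃ (m : ℕ) (a b : X), a ∈ U ∧ (T ^ (N * m)) a ∈ W ∧ b ∈ W ∧ (T ^ (N * m)) b ∈ U := by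
  by_cases hu0 : u = 0
  · subst hu0
    exact ⟨0, 0, 0, mem_of_mem_nhds hU, by simpa using mem_of_mem_nhds hW,
      mem_of_mem_nhds hW, by simpa using mem_of_mem_nhds hU⟩
  obtain ⟨U', hU', W', hW', hdisj⟩ := Filter.disjoint_iff.1 (disjoint_nhds_nhds.2 hu0)
  replace hU' := inter_mem hU hU'
  replace hW' := inter_mem hW hW'
  obtain ⟨W₁, hW₁, hsub₁⟩ := exists_nhds_zero_pow_mem T hW' N
  obtain ⟨n, p, a, hp, haU, hpa, hna⟩ := exists_periodic_mem_pow_mem hu hper hU' hW₁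
  have hn₁ : n ≤ N * (n / N + 1) := (Nat.lt_mul_div_succ n hN).le
  have hn₂ : N * (n / N + 1) - n ≤ N := by
    have := Nat.mul_div_le n N
    rw [Nat.mul_succ]; omega
  have hna' : (T ^ (N * (n / N + 1))) a ∈ W ∩ W' := by
    have := hsub₁ _ hn₂ _ hna
    rwa [← mul_apply_eq_comp, ← pow_add, Nat.sub_add_cancel hn₁] at this
  obtain ⟨W₂, hW₂, hsub₂⟩ := exists_nhds_zero_pow_mem T hW' (N * (n / N + 1) + N * p)
  obtain ⟨k, q, b, hq, hbU, hqb, hkb⟩ := exists_periodic_mem_pow_mem hu hper hU' hW₂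
  obtain ⟨l, hl⟩ : ∃ l, (T ^ l) ((T ^ k) b) = b := by
    refine ⟨(q - 1) * k, ?_⟩
    rw [← mul_apply_eq_comp, ← pow_add, ← Nat.succ_mul, Nat.succ_eq_add_one,
      Nat.sub_add_cancel hq, pow_mul_apply_of_pow_apply hqb]
  have hlt : N * (n / N + 1) + N * p < l := by
    by_contra! hle
    have hbW := hsub₂ l hle _ hkb
    rw [hl] at hbW
    exact disjoint_left.1 hdisj hbU.2 hbW.2
  have hNp : 0 < N * p := Nat.mul_pos hN hp
  set r := (l - N * (n / N + 1)) % (N * p) with hr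
  set d := (l - N * (n / N + 1)) / (N * p) with hd
  have hrlt : r < N * p := Nat.mod_lt _ hNp
  have hrd : N * p * d + r = l - N * (n / N + 1) := Nat.div_add_mod _ _
  have hm : N * (n / N + 1 + p * d) = N * (n / N + 1) + p * (N * d) := by ring
  have hml : N * (n / N + 1 + p * d) + r = l := by
    have : p * (N * d) = N * p * d := by ring
    omega
  refine ⟨n / N + 1 + p * d, a, (T ^ r) ((T ^ k) b), haU.1, ?_, ?_, ?_⟩
  · rw [hm, pow_add, mul_apply_eq_comp, pow_mul_apply_of_pow_apply hpa]
    exact hna'.1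
  · exact (hsub₂ r (by omega) _ hkb).1
  · rw [← mul_apply_eq_comp, ← pow_add, hml, hl]
    exact hbU.1

/-- Birkhoff's transitivity theorem for a sequence of continuous maps. -/
lemma exists_dense_range_of_transitive {Z : Type*} [TopologicalSpace Z] [BaireSpace Z]
    [SecondCountableTopology Z] [Nonempty Z] {B : ℕ → Z → Z} (hB : ∀ n, Continuous (B n))
    (h : ∀ U V : Set Z, IsOpen U → IsOpen V → U.Nonempty → V.Nonempty →
      ∃ n, ∃ z ∈ U, B n z ∈ V) :
    ∃ z, DenseRange fun n => B n z := by
  have hdense : Dense (⋂ V ∈ {V ∈ TopologicalSpace.countableBasis Z | V.Nonempty},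
      ⋃ n, B n ⁻¹' V) := by
    refine dense_biInter_of_isOpen (fun V hV => isOpen_iUnion fun n =>
      (TopologicalSpace.isOpen_of_mem_countableBasis hV.1).preimage (hB n))
      ((TopologicalSpace.countable_countableBasis Z).mono fun V hV => hV.1) fun V hV => ?_
    refine dense_iff_inter_open.2 fun U hU hUne => ?_
    obtain ⟨n, z, hzU, hzV⟩ :=
      h U V hU (TopologicalSpace.isOpen_of_mem_countableBasis hV.1) hUne hV.2
    exact ⟨z, hzU, mem_iUnion.2 ⟨n, hzV⟩⟩
  obtain ⟨z, hz⟩ := hdense.nonempty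
  refine ⟨z, (TopologicalSpace.isBasis_countableBasis Z).dense_iff.2 fun V hV hVne => ?_⟩
  obtain ⟨n, hn⟩ := mem_iUnion.1 (mem_iInter₂.1 hz V ⟨hV, hVne⟩)
  exact ⟨_, hn, n, rfl⟩

/-- The continuous linear maps `F` that intertwine `T ^ n` and `B n` for all multiples `n` of some
`N ≥ 1`. -/
def periodicIntertwiners {X Z : Type*} [NormedAddCommGroup X] [NormedSpace ℝ X]
    [NormedAddCommGroup Z] [NormedSpace ℝ Z] (T : X →L[ℝ] X) (B : ℕ → Z →L[ℝ] Z) :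
    Submodule ℝ (X →L[ℝ] Z) where
  carrier := {F | ∃ N : ℕ, 1 ≤ N ∧ ∀ m x, B (N * m) (F x) = F ((T ^ (N * m)) x)}
  zero_mem' := ⟨1, le_rfl, by simp⟩
  add_mem' := by
    rintro F G ⟨N, hN, hF⟩ ⟨M, hM, hG⟩
    refine ⟨N * M, Nat.mul_pos hN hM, fun m x => ?_⟩
    have hF' := hF (M * m) x
    have hG' := hG (N * m) x
    rw [← mul_assoc] at hF' hG'
    rw [mul_comm M N] at hG'
    simp [hF', hG']
  smul_mem' := by
    rintro c F ⟨N, hN, hF⟩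
    exact ⟨N, hN, fun m x => by simp [hF]⟩

section Intertwiners

variable {X Z : Type*} [NormedAddCommGroup X] [NormedSpace ℝ X]
  [NormedAddCommGroup Z] [NormedSpace ℝ Z] {T : X →L[ℝ] X} {B : ℕ → Z →L[ℝ] Z} {u : X}

lemma transitive_of_dense_intertwiners (hu : Dense {y : X | ∃ n : ℕ, (T ^ n) u = y})
    (hper : Dense {x : X | ∃ n : ℕ, 1 ≤ n ∧ (T ^ n) x = x})
    (hdense : Dense ((fun F : X →L[ℝ] Z => F u) '' periodicIntertwiners T B))
    {U V : Set Z} (hU : IsOpen U) (hV : IsOpen V) (hUne : U.Nonempty) (hVne : V.Nonempty) :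
    ∃ n, ∃ z ∈ U, B n z ∈ V := by
  obtain ⟨_, hFU, F, ⟨N, hN, hF⟩, rfl⟩ := hdense.inter_open_nonempty U hU hUne
  obtain ⟨_, hGV, G, ⟨M, hM, hG⟩, rfl⟩ := hdense.inter_open_nonempty V hV hVne
  have hcont₁ : Continuous fun p : X × X => F p.1 + G p.2 := by fun_prop
  have hnhds₁ : ∀ᶠ p in 𝓝 u ×ˢ 𝓝 (0 : X), F p.1 + G p.2 ∈ U := by
    rw [← nhds_prod_eq]
    exact hcont₁.continuousAt.preimage_mem_nhds (hU.mem_nhds (by simpa using hFU))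
  have hcont₂ : Continuous fun p : X × X => F p.2 + G p.1 := by fun_prop
  have hnhds₂ : ∀ᶠ p in 𝓝 u ×ˢ 𝓝 (0 : X), F p.2 + G p.1 ∈ V := by
    rw [← nhds_prod_eq]
    exact hcont₂.continuousAt.preimage_mem_nhds (hV.mem_nhds (by simpa using hGV))
  obtain ⟨P, hP, W, hW, hPW⟩ := Filter.mem_prod_iff.1 (hnhds₁.and hnhds₂)
  obtain ⟨m, a, b, haP, haW, hbW, hbP⟩ :=
    exists_pow_mul_mem_nhds hu hper (Nat.mul_pos hN hM) hP hW
  refine ⟨N * M * m, F a + G b, (hPW (mk_mem_prod haP hbW)).1, ?_⟩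
  have hF' := hF (M * m) a
  have hG' := hG (N * m) b
  rw [← mul_assoc] at hF' hG'
  rw [mul_comm M N] at hG'
  rw [map_add, hF', hG']
  exact (hPW (mk_mem_prod hbP haW)).2

lemma dense_periodic_of_dense_intertwiners
    (hper : Dense {x : X | ∃ n : ℕ, 1 ≤ n ∧ (T ^ n) x = x})
    (hdense : Dense ((fun F : X →L[ℝ] Z => F u) '' periodicIntertwiners T B)) :
    Dense {z : Z | ∃ n : ℕ, 1 ≤ n ∧ B n z = z} := by
  refine dense_iff_inter_open.2 fun U hU hUne => ?_
  obtain ⟨_, hFU, F, ⟨N, hN, hF⟩, rfl⟩ := hdense.inter_open_nonempty U hU hUne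
  obtain ⟨x, hxU, n, hn, hnx⟩ :=
    hper.inter_open_nonempty (F ⁻¹' U) (hU.preimage F.continuous) ⟨u, hFU⟩
  refine ⟨F x, hxU, N * n, Nat.mul_pos hN hn, ?_⟩
  rw [hF, mul_comm, pow_mul_apply_of_pow_apply hnx]

end Intertwiners

lemma IsC0Semigroup.apply_nat_mul_s6 {X : Type*} [NormedAddCommGroup X] [NormedSpace ℝ X]
    {T : ℝ → X →L[ℝ] X} (hT : IsC0Semigroup T) {t : ℝ} (ht : 0 ≤ t) (n : ℕ) :
    T (n * t) = T t ^ n := by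
  induction n with
  | zero => simpa using hT.1.trans ContinuousLinearMap.one_def.symm
  | succ n ih =>
    rw [Nat.cast_succ, add_mul, one_mul, hT.2.1 _ _ (by positivity) ht, ih, pow_succ]
    rfl

/-- The canonical bilinear map `X × Y → X ⊗̃_α Y` as a continuous bilinear map. -/
noncomputable def UniformCrossNorm.mkL {X Y Z : Type*} [NormedAddCommGroup X] [NormedSpace ℝ X]
    [NormedAddCommGroup Y] [NormedSpace ℝ Y] [NormedAddCommGroup Z] [NormedSpace ℝ Z]
    (c : UniformCrossNorm X Y) (j : TensorProduct ℝ X Y →ₗ[ℝ] Z)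
    (hj : ∀ z, ‖j z‖ = c.α z) : X →L[ℝ] Y →L[ℝ] Z :=
  ((TensorProduct.mk ℝ X Y).compr₂ j).mkContinuous₂ 1 fun x y => by
    simp [hj, c.α_cross]

@[simp]
lemma UniformCrossNorm.mkL_apply {X Y Z : Type*} [NormedAddCommGroup X] [NormedSpace ℝ X]
    [NormedAddCommGroup Y] [NormedSpace ℝ Y] [NormedAddCommGroup Z] [NormedSpace ℝ Z]
    (c : UniformCrossNorm X Y) (j : TensorProduct ℝ X Y →ₗ[ℝ] Z)
    (hj : ∀ z, ‖j z‖ = c.α z) (x : X) (y : Y) : c.mkL j hj x y = j (x ⊗ₜ[ℝ] y) := rfl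

section Completion

variable {X Y Z : Type*} [NormedAddCommGroup X] [NormedSpace ℝ X]
  [NormedAddCommGroup Y] [NormedSpace ℝ Y] [NormedAddCommGroup Z] [NormedSpace ℝ Z]

lemma dense_of_tmul_mem_closure {j : TensorProduct ℝ X Y →ₗ[ℝ] Z} (hj : DenseRange j)
    (E : Submodule ℝ Z) (h : ∀ x y, j (x ⊗ₜ[ℝ] y) ∈ closure (E : Set Z)) :
    Dense (E : Set Z) := by
  have hrange : range j ⊆ closure (E : Set Z) := by
    rintro _ ⟨w, rfl⟩
    rw [← Submodule.topologicalClosure_coe, SetLike.mem_coe]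
    induction w using TensorProduct.induction_on with
    | zero => simp
    | tmul x y => exact h x y
    | add v w hv hw => rw [map_add]; exact add_mem hv hw
  exact dense_closure.1 (hj.mono hrange)

lemma UniformCrossNorm.continuous_tmul (c : UniformCrossNorm X Y)
    {j : TensorProduct ℝ X Y →ₗ[ℝ] Z} (hj : ∀ z, ‖j z‖ = c.α z) :
    Continuous fun p : X × Y => j (p.1 ⊗ₜ[ℝ] p.2) :=
  (c.mkL j hj).continuous₂

lemma UniformCrossNorm.separableSpace [TopologicalSpace.SeparableSpace X]
    [TopologicalSpace.SeparableSpace Y] (c : UniformCrossNorm X Y)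
    {j : TensorProduct ℝ X Y →ₗ[ℝ] Z} (hj : ∀ z, ‖j z‖ = c.α z) (hdense : DenseRange j) :
    TopologicalSpace.SeparableSpace Z := by
  have hspan := (TopologicalSpace.isSeparable_range (c.continuous_tmul hj)).span (R := ℝ)
  have hdense' := dense_of_tmul_mem_closure hdense
    (Submodule.span ℝ (range fun p : X × Y => j (p.1 ⊗ₜ[ℝ] p.2)))
    fun x y => subset_closure (Submodule.subset_span ⟨(x, y), rfl⟩)
  rw [← TopologicalSpace.isSeparable_univ_iff, ← hdense'.closure_eq]
  exact hspan.closure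

end Completion

/-- If `T(t₀)` is a chaotic operator for some `t₀ > 0` and `S(t₀)` has a dense set of
periodic points, then the tensor product semigroup `T(t) ⊗ S(t)` on `X ⊗̃_α Y` is chaotic. -/
theorem tensor_product_chaotic_of_chaotic_time
    {X Y : Type*} [NormedAddCommGroup X] [NormedSpace ℝ X] [CompleteSpace X]
    [TopologicalSpace.SeparableSpace X]
    [NormedAddCommGroup Y] [NormedSpace ℝ Y] [CompleteSpace Y]
    [TopologicalSpace.SeparableSpace Y]
    (T : ℝ → X →L[ℝ] X) (S : ℝ → Y →L[ℝ] Y)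
    (hT : IsC0Semigroup T) (hS : IsC0Semigroup S)
    (t₀ : ℝ) (ht₀ : 0 < t₀) (hTop : IsChaoticOp (T t₀))
    (hSper : Dense {y : Y | ∃ n : ℕ, 1 ≤ n ∧ ((S t₀) ^ n) y = y})
    (c : UniformCrossNorm X Y)
    -- `Z` together with `j` is the completion `X ⊗̃_α Y` of `(X ⊗ Y, α)`:
    {Z : Type*} [NormedAddCommGroup Z] [NormedSpace ℝ Z] [CompleteSpace Z]
    (j : TensorProduct ℝ X Y →ₗ[ℝ] Z)
    (hj_isometry : ∀ z, ‖j z‖ = c.α z)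
    (hj_dense : DenseRange j)
    -- `A` is the extension of the tensor product semigroup `T(t) ⊗ S(t)` to `Z`:
    (A : ℝ → Z →L[ℝ] Z)
    (hA : ∀ t : ℝ, 0 ≤ t → ∀ z : TensorProduct ℝ X Y,
      A t (j z) = j (TensorProduct.map ((T t : X →ₗ[ℝ] X)) ((S t : Y →ₗ[ℝ] Y)) z)) :
    IsChaoticSg A := by
  obtain ⟨⟨u, hu⟩, hper⟩ := hTop
  have := c.separableSpace hj_isometry hj_dense
  have : SecondCountableTopology Z := UniformSpace.secondCountable_of_separable Z
  set B : ℕ → Z →L[ℝ] Z := fun n => A (n * t₀) with hB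
  have hBtmul : ∀ (n : ℕ) (x : X) (y : Y),
      B n (j (x ⊗ₜ[ℝ] y)) = j ((T t₀ ^ n) x ⊗ₜ[ℝ] (S t₀ ^ n) y) := fun n x y => by
    rw [hB, hA _ (by positivity), TensorProduct.map_tmul, hT.apply_nat_mul_s6 ht₀.le,
      hS.apply_nat_mul_s6 ht₀.le]
    rfl
  have hdense : Dense ((fun F : X →L[ℝ] Z => F u) '' periodicIntertwiners (T t₀) B) := by
    refine dense_of_tmul_mem_closure hj_dense ((periodicIntertwiners (T t₀) B).map
      (ContinuousLinearMap.apply ℝ Z u).toLinearMap) fun x y => ?_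
    refine map_mem_closure (f := fun p : X × Y => j (p.1 ⊗ₜ[ℝ] p.2))
      (c.continuous_tmul hj_isometry) (hu.prod hSper (x, y)) ?_
    rintro ⟨_, y⟩ ⟨⟨r, rfl⟩, N, hN, hNy⟩
    refine ⟨((c.mkL j hj_isometry).flip y).comp (T t₀ ^ r), ⟨N, hN, fun m x => ?_⟩, rfl⟩
    simp only [ContinuousLinearMap.comp_apply, ContinuousLinearMap.flip_apply,
      UniformCrossNorm.mkL_apply, hBtmul, pow_mul_apply_of_pow_apply hNy]
    rw [← mul_apply_eq_comp, ← mul_apply_eq_comp, ← pow_add, ← pow_add,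
      add_comm]
  constructor
  · obtain ⟨z, hz⟩ := exists_dense_range_of_transitive (fun n => (B n).continuous)
      fun U V hU hV => transitive_of_dense_intertwiners hu hper hdense hU hV
    refine ⟨z, hz.mono ?_⟩
    rintro _ ⟨n, rfl⟩
    exact ⟨n * t₀, by positivity, rfl⟩
  · refine (dense_periodic_of_dense_intertwiners hper hdense).mono ?_
    rintro z ⟨n, hn, hnz⟩
    have : (0 : ℝ) < n := by exact_mod_cast hn
    exact ⟨n * t₀, by positivity, hnz⟩
end

section
/- Let X and Y be separable Banach spaces, let (T(t))_{t≥0} and (S(t))_{t≥0} be strongly continuous semigroups on X and Y respectively, and let α be a uniform crossnorm on the algebraic tensor product X ⊗ Y. If there exist natural numbers p₁, p₂, q₁, q₂ ≥ 1 such that the operators T(p₁/q₁) and S(p₂/q₂) are chaotic operators, then the tensor product semigroup T(t) ⊗ S(t) on the completion X ⊗̃_α Y is a chaotic semigroup. -/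
open Set Filter Topology TensorProduct

/-- A set of natural numbers such that every arithmetic progression contains a
sub-progression lying in the set. -/
def MeetsProgressions (s : Set ℕ) : Prop :=
  ∀ k p : ℕ, 0 < p → ∃ k' p' : ℕ, 0 < p' ∧
    ∀ n, k' + p' * n ∈ s ∧ ∃ m, k' + p' * n = k + p * m

namespace MeetsProgressions

theorem univ : MeetsProgressions Set.univ := fun k p hp =>
  ⟨k, p, hp, fun n => ⟨mem_univ _, n, rfl⟩⟩

theorem mono {s t : Set ℕ} (hs : MeetsProgressions s) (hst : s ⊆ t) : MeetsProgressions t := by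
  intro k p hp
  obtain ⟨k', p', hp', h⟩ := hs k p hp
  exact ⟨k', p', hp', fun n => ⟨hst (h n).1, (h n).2⟩⟩

theorem inter {s t : Set ℕ} (hs : MeetsProgressions s) (ht : MeetsProgressions t) :
    MeetsProgressions (s ∩ t) := by
  intro k p hp
  obtain ⟨k₁, p₁, hp₁, h₁⟩ := hs k p hp
  obtain ⟨k₂, p₂, hp₂, h₂⟩ := ht k₁ p₁ hp₁
  refine ⟨k₂, p₂, hp₂, fun n => ?_⟩
  obtain ⟨hn, m, hm⟩ := h₂ n
  refine ⟨⟨?_, hn⟩, ?_⟩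
  · rw [hm]; exact (h₁ m).1
  · rw [hm]; exact (h₁ m).2

theorem nonempty {s : Set ℕ} (hs : MeetsProgressions s) : s.Nonempty := by
  obtain ⟨k, p, -, h⟩ := hs 0 1 one_pos
  exact ⟨_, (h 0).1⟩

end MeetsProgressions

/-- Topological transitivity of a self-map. -/
def IsTransitiveMap {X : Type*} [TopologicalSpace X] (f : X → X) : Prop :=
  ∀ U V : Set X, IsOpen U → IsOpen V → U.Nonempty → V.Nonempty →
    ∃ n : ℕ, ∃ x ∈ U, f^[n] x ∈ V

section Transitive

variable {X : Type*}

theorem isTransitiveMap_of_dense_orbit [NormedAddCommGroup X] [NormedSpace ℝ X]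
    {f : X → X} {x : X} (hx : Dense (range fun n : ℕ => f^[n] x)) : IsTransitiveMap f := by
  intro U V hU hV hUne hVne
  rcases subsingleton_or_nontrivial X with hX | hX
  · obtain ⟨u, hu⟩ := hUne
    obtain ⟨v, hv⟩ := hVne
    exact ⟨0, u, hu, by rwa [Subsingleton.elim (f^[0] u) v]⟩
  · have : ∀ x : X, (𝓝[≠] x).NeBot := fun x => Module.punctured_nhds_neBot ℝ X x
    obtain ⟨_, ⟨n, rfl⟩, hn⟩ := hx.exists_mem_open hU hUne
    have hfin : ((fun n : ℕ => f^[n] x) '' Iio n).Finite := (finite_Iio n).image _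
    obtain ⟨_, ⟨⟨m, rfl⟩, hm'⟩, hm⟩ := (hx.sdiff_finite hfin).exists_mem_open hV hVne
    have hnm : n ≤ m := by
      by_contra! h
      exact hm' ⟨m, h, rfl⟩
    refine ⟨m - n, f^[n] x, hn, ?_⟩
    rwa [← Function.iterate_add_apply, Nat.sub_add_cancel hnm]

/-- Birkhoff's transitivity theorem. -/
theorem IsTransitiveMap.exists_dense_orbit [TopologicalSpace X] [BaireSpace X] [Nonempty X]
    [SecondCountableTopology X] {f : X → X} (hf : IsTransitiveMap f) (hc : Continuous f) :
    ∃ x, Dense (range fun n : ℕ => f^[n] x) := by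
  let b := TopologicalSpace.countableBasis X
  have hd : Dense (⋂ V ∈ b, ⋃ n : ℕ, f^[n] ⁻¹' V) := by
    refine dense_biInter_of_isOpen (fun V hV => ?_) (TopologicalSpace.countable_countableBasis X)
      (fun V hV => ?_)
    · exact isOpen_iUnion fun n =>
        (TopologicalSpace.isOpen_of_mem_countableBasis hV).preimage (hc.iterate n)
    · refine dense_iff_inter_open.2 fun U hU hUne => ?_
      obtain ⟨n, x, hxU, hxV⟩ := hf U V hU (TopologicalSpace.isOpen_of_mem_countableBasis hV)
        hUne (TopologicalSpace.nonempty_of_mem_countableBasis hV)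
      exact ⟨x, hxU, mem_iUnion.2 ⟨n, hxV⟩⟩
  obtain ⟨x, hx⟩ := hd.nonempty
  refine ⟨x, (TopologicalSpace.isBasis_countableBasis X).dense_iff.2 fun V hV _ => ?_⟩
  obtain ⟨n, hn⟩ := mem_iUnion.1 (mem_iInter₂.1 hx V hV)
  exact ⟨_, hn, n, rfl⟩

theorem IsTransitiveMap.exists_periodicPts_iterate_mem [TopologicalSpace X] {f : X → X}
    (hf : IsTransitiveMap f) (hc : Continuous f) (hper : Dense (Function.periodicPts f))
    {U V : Set X} (hU : IsOpen U) (hV : IsOpen V) (hUne : U.Nonempty) (hVne : V.Nonempty)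
    (N : ℕ) : ∃ x ∈ U, x ∈ Function.periodicPts f ∧ ∃ n, N ≤ n ∧ f^[n] x ∈ V := by
  obtain ⟨n, x, hxU, hxV⟩ := hf U V hU hV hUne hVne
  obtain ⟨y, hyper, hyU, hyV⟩ := hper.exists_mem_open
    (hU.inter (hV.preimage (hc.iterate n))) ⟨x, hxU, hxV⟩
  obtain ⟨p, hp, hy⟩ := hyper
  refine ⟨y, hyU, ⟨p, hp, hy⟩, n + p * N, by nlinarith, ?_⟩
  rwa [Function.iterate_add_apply, (hy.mul_const N).eq]

variable [NormedAddCommGroup X] [NormedSpace ℝ X] {T : X →L[ℝ] X}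

theorem ContinuousLinearMap.exists_nhds_zero_iterate_mem (T : X →L[ℝ] X) {W : Set X}
    (hW : IsOpen W) (h0 : (0 : X) ∈ W) (p : ℕ) :
    ∃ W' : Set X, IsOpen W' ∧ (0 : X) ∈ W' ∧ ∀ x ∈ W', ∀ i < p, T^[i] x ∈ W := by
  refine ⟨⋂ i ∈ Iio p, T^[i] ⁻¹' W,
    (finite_Iio p).isOpen_biInter fun i _ => hW.preimage (T.continuous.iterate i), ?_, ?_⟩
  · refine mem_iInter₂.2 fun i _ => ?_
    rwa [mem_preimage, iterate_map_zero]
  · intro x hx i hi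
    exact mem_iInter₂.1 hx i hi

theorem IsTransitiveMap.meetsProgressions_to_zero (hT : IsTransitiveMap T)
    (hper : Dense (Function.periodicPts T)) {U W : Set X} (hU : IsOpen U) (hUne : U.Nonempty)
    (hW : IsOpen W) (h0 : (0 : X) ∈ W) :
    MeetsProgressions {n | ∃ u ∈ U, T^[n] u ∈ W} := by
  intro k p hp
  obtain ⟨W', hW', h0', hWW'⟩ := T.exists_nhds_zero_iterate_mem hW h0 p
  obtain ⟨x, hxU, ⟨q, hq, hx⟩, n, hn, hxn⟩ := hT.exists_periodicPts_iterate_mem T.continuous hper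
    hU hW' hUne ⟨0, h0'⟩ k
  obtain ⟨i, hi, m, hm⟩ : ∃ i < p, ∃ m, i + n = k + p * m := by
    obtain ⟨d, rfl⟩ := Nat.exists_eq_add_of_le hn
    have h1 := Nat.div_add_mod d p
    have h2 := Nat.mod_lt d hp
    rcases Nat.eq_zero_or_pos (d % p) with h | h
    · exact ⟨0, hp, d / p, by omega⟩
    · exact ⟨p - d % p, by omega, d / p + 1, by rw [mul_add]; omega⟩
  refine ⟨i + n, q * p, Nat.mul_pos hq hp, fun l => ⟨⟨x, hxU, ?_⟩, m + q * l, by rw [hm]; ring⟩⟩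
  rw [Function.iterate_add_apply, mul_assoc, (hx.mul_const (p * l)).eq,
    Function.iterate_add_apply]
  exact hWW' _ hxn i hi

theorem IsTransitiveMap.meetsProgressions_from_zero (hT : IsTransitiveMap T)
    (hper : Dense (Function.periodicPts T)) {V W : Set X} (hV : IsOpen V) (hVne : V.Nonempty)
    (hW : IsOpen W) (h0 : (0 : X) ∈ W) :
    MeetsProgressions {n | ∃ w ∈ W, T^[n] w ∈ V} := by
  intro k p hp
  obtain ⟨W', hW', h0', hWW'⟩ := T.exists_nhds_zero_iterate_mem hW h0 p
  obtain ⟨x, hxW, ⟨q, hq, hx⟩, n, hn, hxn⟩ := hT.exists_periodicPts_iterate_mem T.continuous hper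
    hW' hV ⟨0, h0'⟩ hVne k
  obtain ⟨d, rfl⟩ := Nat.exists_eq_add_of_le hn
  have h1 := Nat.div_add_mod d p
  have h2 := Nat.mod_lt d hp
  refine ⟨k + p * (d / p), q * p, Nat.mul_pos hq hp, fun l => ⟨⟨T^[d % p] x, hWW' x hxW _ h2, ?_⟩,
    d / p + q * l, by ring⟩⟩
  rw [← Function.iterate_add_apply,
    show k + p * (d / p) + q * p * l + d % p = k + d + q * (p * l) by rw [← mul_assoc]; omega,
    Function.iterate_add_apply, (hx.mul_const (p * l)).eq]
  exact hxn

end Transitive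

theorem exists_norm_iterate_le_of_mem_periodicPts {Y : Type*} [NormedAddCommGroup Y] {f : Y → Y}
    {y : Y} (hy : y ∈ Function.periodicPts f) : ∃ C : ℝ, 0 < C ∧ ∀ n, ‖f^[n] y‖ ≤ C := by
  obtain ⟨m, hm, hy⟩ := hy
  refine ⟨∑ i ∈ Finset.range m, ‖f^[i] y‖ + 1, by positivity, fun n => ?_⟩
  rw [← hy.iterate_mod_apply n]
  have := Finset.single_le_sum (f := fun i => ‖f^[i] y‖) (fun i _ => norm_nonneg _)
    (Finset.mem_range.2 (Nat.mod_lt n hm))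
  linarith

section Collapse

variable {Z : Type*} [NormedAddCommGroup Z] [NormedSpace ℝ Z]

/-- Vectors that can be perturbed slightly so as to be sent near zero by `A^n`, for `n` in
a set meeting all progressions. -/
def collapsible (A : Z →L[ℝ] Z) : AddSubmonoid Z where
  carrier := {z | ∀ ε > 0, MeetsProgressions {n | ∃ u, ‖u - z‖ < ε ∧ ‖A^[n] u‖ < ε}}
  zero_mem' := fun ε hε => MeetsProgressions.univ.mono fun n _ =>
    ⟨0, by simpa using hε, by simpa [iterate_map_zero] using hε⟩
  add_mem' := by
    intro a b ha hb ε hε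
    refine ((ha (ε / 2) (half_pos hε)).inter (hb (ε / 2) (half_pos hε))).mono ?_
    rintro n ⟨⟨u, hu, hu'⟩, v, hv, hv'⟩
    refine ⟨u + v, ?_, ?_⟩
    · rw [add_sub_add_comm]
      linarith [norm_add_le (u - a) (v - b)]
    · rw [iterate_map_add]
      linarith [norm_add_le (A^[n] u) (A^[n] v)]

/-- Vectors that are nearly reached by `A^n` from near zero, for `n` in
a set meeting all progressions. -/
def emergent (A : Z →L[ℝ] Z) : AddSubmonoid Z where
  carrier := {z | ∀ ε > 0, MeetsProgressions {n | ∃ u, ‖u‖ < ε ∧ ‖A^[n] u - z‖ < ε}}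
  zero_mem' := fun ε hε => MeetsProgressions.univ.mono fun n _ =>
    ⟨0, by simpa using hε, by simpa [iterate_map_zero] using hε⟩
  add_mem' := by
    intro a b ha hb ε hε
    refine ((ha (ε / 2) (half_pos hε)).inter (hb (ε / 2) (half_pos hε))).mono ?_
    rintro n ⟨⟨u, hu, hu'⟩, v, hv, hv'⟩
    refine ⟨u + v, ?_, ?_⟩
    · linarith [norm_add_le u v]
    · rw [iterate_map_add, add_sub_add_comm]
      linarith [norm_add_le (A^[n] u - a) (A^[n] v - b)]

/-- The periodic points of a linear operator. -/
def periodicSubmonoid (A : Z →L[ℝ] Z) : AddSubmonoid Z where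
  carrier := Function.periodicPts A
  zero_mem' := ⟨1, one_pos, map_zero A⟩
  add_mem' := by
    rintro a b ⟨m, hm, ha⟩ ⟨n, hn, hb⟩
    refine ⟨m * n, Nat.mul_pos hm hn, ?_⟩
    rw [Function.IsPeriodicPt, Function.IsFixedPt, iterate_map_add, (ha.mul_const n).eq,
      (hb.const_mul m).eq]

theorem isClosed_collapsible (A : Z →L[ℝ] Z) : IsClosed (collapsible A : Set Z) := by
  refine isClosed_of_closure_subset fun z hz ε hε => ?_
  obtain ⟨w, hw, hzw⟩ := Metric.mem_closure_iff.1 hz (ε / 2) (half_pos hε)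
  refine (hw (ε / 2) (half_pos hε)).mono ?_
  rintro n ⟨u, hu, hu'⟩
  refine ⟨u, ?_, by linarith⟩
  rw [dist_comm, dist_eq_norm] at hzw
  linarith [norm_sub_le_norm_sub_add_norm_sub u w z]

theorem isClosed_emergent (A : Z →L[ℝ] Z) : IsClosed (emergent A : Set Z) := by
  refine isClosed_of_closure_subset fun z hz ε hε => ?_
  obtain ⟨w, hw, hzw⟩ := Metric.mem_closure_iff.1 hz (ε / 2) (half_pos hε)
  refine (hw (ε / 2) (half_pos hε)).mono ?_
  rintro n ⟨u, hu, hu'⟩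
  refine ⟨u, by linarith, ?_⟩
  rw [dist_comm, dist_eq_norm] at hzw
  linarith [norm_sub_le_norm_sub_add_norm_sub (A^[n] u) w z]

theorem isTransitiveMap_of_collapsible_of_emergent {A : Z →L[ℝ] Z}
    (hcol : ∀ z, z ∈ collapsible A) (hem : ∀ z, z ∈ emergent A) : IsTransitiveMap A := by
  rintro U V hU hV ⟨a, ha⟩ ⟨b, hb⟩
  obtain ⟨δ, hδ, hδU⟩ := Metric.isOpen_iff.1 hU a ha
  obtain ⟨η, hη, hηV⟩ := Metric.isOpen_iff.1 hV b hb
  obtain ⟨n, ⟨u, hu, hu'⟩, w, hw, hw'⟩ := ((hcol a (min δ η / 2) (by positivity)).inter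
    (hem b (min δ η / 2) (by positivity))).nonempty
  have h1 := min_le_left δ η
  have h2 := min_le_right δ η
  refine ⟨n, u + w, hδU ?_, hηV ?_⟩
  · rw [mem_ball_iff_norm, add_sub_right_comm]
    linarith [norm_add_le (u - a) w]
  · rw [mem_ball_iff_norm, iterate_map_add, add_sub_assoc]
    linarith [norm_add_le (A^[n] u) (A^[n] w - b)]

end Collapse

section Bilinear

variable {X Y Z : Type*} [NormedAddCommGroup X] [NormedSpace ℝ X]
  [NormedAddCommGroup Y] [NormedSpace ℝ Y] [NormedAddCommGroup Z] [NormedSpace ℝ Z]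
  {B : X →L[ℝ] Y →L[ℝ] Z} {T : X →L[ℝ] X} {S : Y →L[ℝ] Y} {A : Z →L[ℝ] Z}

theorem AddSubmonoid.eq_top_of_isClosed_of_bilinear_mem
    (hB : Dense (AddSubmonoid.closure {z | ∃ x y, B x y = z} : Set Z))
    {D : Set X} {E : Set Y} (hD : Dense D) (hE : Dense E) {G : AddSubmonoid Z}
    (hG : IsClosed (G : Set Z)) (hmem : ∀ x ∈ D, ∀ y ∈ E, B x y ∈ G) (z : Z) : z ∈ G := by
  have hBc : Continuous fun q : X × Y => B q.1 q.2 := B.isBoundedBilinearMap.continuous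
  have hall : ∀ q : X × Y, B q.1 q.2 ∈ G := fun q =>
    (hD.prod hE).induction (P := fun q => B q.1 q.2 ∈ G)
      (fun q hq => hmem q.1 hq.1 q.2 hq.2) (hG.preimage hBc) q
  have hle : AddSubmonoid.closure {z | ∃ x y, B x y = z} ≤ G := by
    rw [AddSubmonoid.closure_le]
    rintro _ ⟨x, y, rfl⟩
    exact hall (x, y)
  exact hG.closure_subset_iff.2 hle (hB z)

theorem iterate_bilinear_apply (hA : ∀ x y, A (B x y) = B (T x) (S y)) (n : ℕ) (x : X) (y : Y) :
    A^[n] (B x y) = B (T^[n] x) (S^[n] y) := by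
  induction n generalizing x y with
  | zero => rfl
  | succ n ih => rw [Function.iterate_succ_apply, hA, ih]; rfl

theorem bilinear_mem_collapsible (hA : ∀ x y, A (B x y) = B (T x) (S y))
    (hT : IsTransitiveMap T) (hTper : Dense (Function.periodicPts T)) (x : X) {y : Y}
    (hy : y ∈ Function.periodicPts S) : B x y ∈ collapsible A := by
  intro ε hε
  obtain ⟨C, hC, hyC⟩ := exists_norm_iterate_le_of_mem_periodicPts hy
  obtain ⟨δ, hδ, hδε⟩ : ∃ δ > 0, ‖B‖ * C * δ < ε := exists_pos_mul_lt hε _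
  have hbound : ∀ v : X, ‖v‖ < δ → ∀ n, ‖B v (S^[n] y)‖ < ε := fun v hv n =>
    calc ‖B v (S^[n] y)‖ ≤ ‖B‖ * ‖v‖ * ‖S^[n] y‖ := B.le_opNorm₂ _ _
      _ ≤ ‖B‖ * δ * C := by gcongr; exact hyC n
      _ < ε := by linarith
  refine (hT.meetsProgressions_to_zero hTper (Metric.isOpen_ball (x := x) (ε := δ))
    ⟨x, Metric.mem_ball_self hδ⟩ Metric.isOpen_ball (Metric.mem_ball_self hδ)).mono ?_
  rintro n ⟨u, hu, hun⟩
  refine ⟨B u y, ?_, ?_⟩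
  · rw [← sub_apply, ← map_sub]
    exact hbound _ (mem_ball_iff_norm.1 hu) 0
  · rw [iterate_bilinear_apply hA]
    exact hbound _ (mem_ball_zero_iff.1 hun) n

theorem bilinear_mem_emergent (hA : ∀ x y, A (B x y) = B (T x) (S y))
    (hT : IsTransitiveMap T) (hTper : Dense (Function.periodicPts T)) (x : X) {y : Y}
    (hy : y ∈ Function.periodicPts S) : B x y ∈ emergent A := by
  intro ε hε
  obtain ⟨C, hC, hyC⟩ := exists_norm_iterate_le_of_mem_periodicPts hy
  obtain ⟨m, hm, hym⟩ := hy
  obtain ⟨δ, hδ, hδε⟩ : ∃ δ > 0, ‖B‖ * C * δ < ε := exists_pos_mul_lt hε _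
  have hbound : ∀ v : X, ‖v‖ < δ → ∀ n, ‖B v (S^[n] y)‖ < ε := fun v hv n =>
    calc ‖B v (S^[n] y)‖ ≤ ‖B‖ * ‖v‖ * ‖S^[n] y‖ := B.le_opNorm₂ _ _
      _ ≤ ‖B‖ * δ * C := by gcongr; exact hyC n
      _ < ε := by linarith
  refine (hT.meetsProgressions_from_zero hTper (Metric.isOpen_ball (x := x) (ε := δ))
    ⟨x, Metric.mem_ball_self hδ⟩ Metric.isOpen_ball (Metric.mem_ball_self hδ)).mono ?_
  rintro n ⟨w, hw, hwn⟩
  refine ⟨B w (S^[(m - 1) * n] y), hbound _ (mem_ball_zero_iff.1 hw) _, ?_⟩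
  have hmn : n + (m - 1) * n = m * n := by
    obtain ⟨m, rfl⟩ := Nat.exists_eq_succ_of_ne_zero hm.ne'
    simp only [Nat.succ_eq_add_one, Nat.add_sub_cancel]
    ring
  rw [iterate_bilinear_apply hA, ← Function.iterate_add_apply, hmn, (hym.mul_const n).eq,
    ← sub_apply, ← map_sub]
  exact hbound _ (mem_ball_iff_norm.1 hwn) 0

theorem isTransitiveMap_of_bilinear
    (hB : Dense (AddSubmonoid.closure {z | ∃ x y, B x y = z} : Set Z))
    (hA : ∀ x y, A (B x y) = B (T x) (S y)) (hT : IsTransitiveMap T)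
    (hTper : Dense (Function.periodicPts T)) (hSper : Dense (Function.periodicPts S)) :
    IsTransitiveMap A :=
  isTransitiveMap_of_collapsible_of_emergent
    (AddSubmonoid.eq_top_of_isClosed_of_bilinear_mem hB hTper hSper (isClosed_collapsible A)
      fun x _ _ hy => bilinear_mem_collapsible hA hT hTper x hy)
    (AddSubmonoid.eq_top_of_isClosed_of_bilinear_mem hB hTper hSper (isClosed_emergent A)
      fun x _ _ hy => bilinear_mem_emergent hA hT hTper x hy)

theorem dense_periodicPts_of_bilinear
    (hB : Dense (AddSubmonoid.closure {z | ∃ x y, B x y = z} : Set Z))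
    (hA : ∀ x y, A (B x y) = B (T x) (S y))
    (hTper : Dense (Function.periodicPts T)) (hSper : Dense (Function.periodicPts S)) :
    Dense (Function.periodicPts A) := by
  refine AddSubmonoid.eq_top_of_isClosed_of_bilinear_mem hB hTper hSper
    (G := (periodicSubmonoid A).topologicalClosure) isClosed_closure ?_
  rintro x ⟨m, hm, hx⟩ y ⟨n, hn, hy⟩
  refine subset_closure ⟨m * n, Nat.mul_pos hm hn, ?_⟩
  rw [Function.IsPeriodicPt, Function.IsFixedPt, iterate_bilinear_apply hA,
    (hx.mul_const n).eq, (hy.const_mul m).eq]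

theorem separableSpace_of_bilinear [TopologicalSpace.SeparableSpace X]
    [TopologicalSpace.SeparableSpace Y]
    (hB : Dense (AddSubmonoid.closure {z | ∃ x y, B x y = z} : Set Z)) :
    TopologicalSpace.SeparableSpace Z := by
  have hBc : Continuous fun q : X × Y => B q.1 q.2 := B.isBoundedBilinearMap.continuous
  have hsep := (TopologicalSpace.isSeparable_range hBc).span (R := ℝ)
  refine TopologicalSpace.isSeparable_univ_iff.1 (hsep.closure.mono fun z _ => ?_)
  suffices h : AddSubmonoid.closure {z | ∃ x y, B x y = z} ≤
      (Submodule.span ℝ (range fun q : X × Y => B q.1 q.2)).toAddSubmonoid from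
    closure_mono h (hB z)
  rw [AddSubmonoid.closure_le]
  rintro _ ⟨x, y, rfl⟩
  exact Submodule.subset_span ⟨(x, y), rfl⟩

end Bilinear

theorem iterate_eq_of_semigroup {X : Type*} [NormedAddCommGroup X] [NormedSpace ℝ X]
    {T : ℝ → X →L[ℝ] X} (h0 : T 0 = ContinuousLinearMap.id ℝ X)
    (hadd : ∀ s t : ℝ, 0 ≤ s → 0 ≤ t → T (s + t) = (T s).comp (T t)) {s : ℝ} (hs : 0 ≤ s)
    (n : ℕ) (x : X) : (T s)^[n] x = T (n * s) x := by
  induction n generalizing x with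
  | zero => simp [h0]
  | succ n ih =>
    rw [Function.iterate_succ_apply, ih, Nat.cast_succ, add_mul, one_mul,
      hadd _ _ (by positivity) hs, ContinuousLinearMap.comp_apply]

theorem isTransitiveMap_of_isChaoticOp {X : Type*} [NormedAddCommGroup X] [NormedSpace ℝ X]
    {T : X →L[ℝ] X} (hT : IsChaoticOp T) : IsTransitiveMap T := by
  obtain ⟨x, hx⟩ := hT.1
  refine isTransitiveMap_of_dense_orbit (x := x) (hx.mono ?_)
  rintro _ ⟨n, rfl⟩
  exact ⟨n, by rw [FunLike.coe_pow_eq_iterate]⟩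

theorem dense_periodicPts_of_isChaoticOp {X : Type*} [NormedAddCommGroup X] [NormedSpace ℝ X]
    {T : X →L[ℝ] X} (hT : IsChaoticOp T) : Dense (Function.periodicPts T) := by
  refine hT.2.mono ?_
  rintro x ⟨n, hn, hx⟩
  exact ⟨n, hn, by rwa [FunLike.coe_pow_eq_iterate] at hx⟩

/-- Periods of `T(s)` transfer to `T(t)` when `s` and `t` are commensurable. -/
theorem periodicPts_subset_of_commensurable {X : Type*} [NormedAddCommGroup X] [NormedSpace ℝ X]
    {T : ℝ → X →L[ℝ] X} (h0 : T 0 = ContinuousLinearMap.id ℝ X)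
    (hadd : ∀ s t : ℝ, 0 ≤ s → 0 ≤ t → T (s + t) = (T s).comp (T t)) {s t : ℝ} (hs : 0 ≤ s)
    (ht : 0 ≤ t) {a b : ℕ} (hb : 0 < b) (hst : (a : ℝ) * s = b * t) :
    Function.periodicPts (T s) ⊆ Function.periodicPts (T t) := by
  rintro x ⟨m, hm, hx⟩
  refine ⟨m * b, Nat.mul_pos hm hb, ?_⟩
  have h := (hx.mul_const a).eq
  rw [iterate_eq_of_semigroup h0 hadd hs] at h
  rw [Function.IsPeriodicPt, Function.IsFixedPt, iterate_eq_of_semigroup h0 hadd ht,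
    ← show ((m * a : ℕ) : ℝ) * s = (m * b : ℕ) * t by push_cast; rw [mul_assoc, hst, mul_assoc]]
  exact h

theorem exists_bilinear_of_uniformCrossNorm {X Y Z : Type*} [NormedAddCommGroup X]
    [NormedSpace ℝ X] [NormedAddCommGroup Y] [NormedSpace ℝ Y] [NormedAddCommGroup Z]
    [NormedSpace ℝ Z] (c : UniformCrossNorm X Y) (j : TensorProduct ℝ X Y →ₗ[ℝ] Z)
    (hj_isometry : ∀ z, ‖j z‖ = c.α z) (hj_dense : DenseRange j) :
    ∃ B : X →L[ℝ] Y →L[ℝ] Z, (∀ x y, B x y = j (x ⊗ₜ[ℝ] y)) ∧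
      Dense (AddSubmonoid.closure {z | ∃ x y, B x y = z} : Set Z) := by
  refine ⟨((TensorProduct.mk ℝ X Y).compr₂ j).mkContinuous₂ 1 fun x y => ?_, fun x y => rfl, ?_⟩
  · simp [hj_isometry, c.α_cross]
  · refine hj_dense.mono ?_
    rintro _ ⟨z, rfl⟩
    induction z with
    | zero => rw [map_zero]; exact zero_mem _
    | tmul x y => exact AddSubmonoid.subset_closure ⟨x, y, rfl⟩
    | add z w hz hw => rw [map_add]; exact add_mem hz hw

/-- If `T(p₁/q₁)` and `S(p₂/q₂)` are chaotic operators for natural numbers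
`p₁, p₂, q₁, q₂ ≥ 1`, then the tensor product semigroup `T(t) ⊗ S(t)` on `X ⊗̃_α Y`
is chaotic. -/
theorem tensor_product_chaotic_of_rational_chaotic_times
    {X Y : Type*} [NormedAddCommGroup X] [NormedSpace ℝ X] [CompleteSpace X]
    [TopologicalSpace.SeparableSpace X]
    [NormedAddCommGroup Y] [NormedSpace ℝ Y] [CompleteSpace Y]
    [TopologicalSpace.SeparableSpace Y]
    (T : ℝ → X →L[ℝ] X) (S : ℝ → Y →L[ℝ] Y)
    (hT : IsC0Semigroup T) (hS : IsC0Semigroup S)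
    (p₁ p₂ q₁ q₂ : ℕ) (hp₁ : 1 ≤ p₁) (hp₂ : 1 ≤ p₂) (hq₁ : 1 ≤ q₁) (hq₂ : 1 ≤ q₂)
    (hTop : IsChaoticOp (T ((p₁ : ℝ) / (q₁ : ℝ))))
    (hSop : IsChaoticOp (S ((p₂ : ℝ) / (q₂ : ℝ))))
    (c : UniformCrossNorm X Y)
    -- `Z` together with `j` is the completion `X ⊗̃_α Y` of `(X ⊗ Y, α)`:
    {Z : Type*} [NormedAddCommGroup Z] [NormedSpace ℝ Z] [CompleteSpace Z]
    (j : TensorProduct ℝ X Y →ₗ[ℝ] Z)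
    (hj_isometry : ∀ z, ‖j z‖ = c.α z)
    (hj_dense : DenseRange j)
    -- `A` is the extension of the tensor product semigroup `T(t) ⊗ S(t)` to `Z`:
    (A : ℝ → Z →L[ℝ] Z)
    (hA : ∀ t : ℝ, 0 ≤ t → ∀ z : TensorProduct ℝ X Y,
      A t (j z) = j (TensorProduct.map ((T t : X →ₗ[ℝ] X)) ((S t : Y →ₗ[ℝ] Y)) z)) :
    IsChaoticSg A := by
  obtain ⟨B, hBj, hB⟩ := exists_bilinear_of_uniformCrossNorm c j hj_isometry hj_dense
  have hA0 : A 0 = ContinuousLinearMap.id ℝ Z := by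
    refine ContinuousLinearMap.coeFn_injective
      (hj_dense.equalizer (A 0).continuous continuous_id (funext fun z => ?_))
    simp [hA 0 le_rfl, hT.1, hS.1]
  have hAadd : ∀ s t : ℝ, 0 ≤ s → 0 ≤ t → A (s + t) = (A s).comp (A t) := by
    intro s t hs ht
    refine ContinuousLinearMap.coeFn_injective (hj_dense.equalizer (A (s + t)).continuous
      ((A s).comp (A t)).continuous (funext fun z => ?_))
    simp only [Function.comp_apply, ContinuousLinearMap.comp_apply, hA _ hs, hA _ ht,
      hA _ (add_nonneg hs ht), hT.2.1 s t hs ht, hS.2.1 s t hs ht,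
      ContinuousLinearMap.toLinearMap_comp, TensorProduct.map_comp, LinearMap.comp_apply]
  have hq₁' : (0 : ℝ) < q₁ := by exact_mod_cast hq₁
  have hq₂' : (0 : ℝ) < q₂ := by exact_mod_cast hq₂
  have hp₁' : (0 : ℝ) < p₁ := by exact_mod_cast hp₁
  set s : ℝ := (p₁ : ℝ) / q₁ with hs_def
  have hs : 0 < s := by positivity
  have hAB : ∀ x y, A s (B x y) = B (T s x) (S s y) := fun x y => by
    rw [hBj, hBj, hA s hs.le]; rfl
  have hTper := dense_periodicPts_of_isChaoticOp hTop
  have hSper : Dense (Function.periodicPts (S s)) :=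
    (dense_periodicPts_of_isChaoticOp hSop).mono <|
      periodicPts_subset_of_commensurable hS.1 hS.2.1 (by positivity) hs.le
        (a := p₁ * q₂) (b := p₂ * q₁) (Nat.mul_pos hp₂ hq₁) (by rw [hs_def]; push_cast; field_simp)
  have hsep := separableSpace_of_bilinear hB
  have hsec := UniformSpace.secondCountable_of_separable Z
  refine ⟨?_, (dense_periodicPts_of_bilinear hB hAB hTper hSper).mono ?_⟩
  · obtain ⟨z, hz⟩ := (isTransitiveMap_of_bilinear hB hAB
      (isTransitiveMap_of_isChaoticOp hTop) hTper hSper).exists_dense_orbit (A s).continuous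
    refine ⟨z, hz.mono ?_⟩
    rintro _ ⟨n, rfl⟩
    exact ⟨n * s, by positivity, (iterate_eq_of_semigroup hA0 hAadd hs.le n z).symm⟩
  · rintro z ⟨n, hn, hz⟩
    have hn' : (0 : ℝ) < n := by exact_mod_cast hn
    exact ⟨n * s, by positivity, by rw [← iterate_eq_of_semigroup hA0 hAadd hs.le]; exact hz⟩
end

section
/- Let X and Y be separable Banach spaces, let (T(t))_{t≥0} and (S(t))_{t≥0} be strongly continuous semigroups on X and Y respectively, and let n ≥ 1. If the product semigroup T(t) × S(t) on X × Y (with the sup norm) satisfies the hypercyclicity criterion, then the semigroup T^n(t) × S^n(t) := T(t) × ⋯ × T(t) × S(t) × ⋯ × S(t) (n factors of each) on Xⁿ × Yⁿ (with the sup norm) satisfies the hypercyclicity criterion. -/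
open Set Filter Topology TensorProduct

/-- A family of operators satisfying the hypercyclicity criterion is topologically transitive. -/
theorem SatisfiesHC.exists_mem_mem {Z : Type*} [NormedAddCommGroup Z] [NormedSpace ℝ Z]
    {R : ℝ → Z →L[ℝ] Z} (hR : SatisfiesHC R) {U V : Set Z} (hU : IsOpen U) (hV : IsOpen V)
    (hU' : U.Nonempty) (hV' : V.Nonempty) : ∃ t : ℝ, 0 < t ∧ ∃ z ∈ U, R t z ∈ V := by
  obtain ⟨u, hu⟩ := hU'
  obtain ⟨v, hv⟩ := hV'
  have hadd (a : Z) {A : Set Z} (hA : IsOpen A) (ha : a ∈ A) :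
      ∃ B C : Set Z, IsOpen B ∧ IsOpen C ∧ a ∈ B ∧ (0 : Z) ∈ C ∧
        ∀ b ∈ B, ∀ c ∈ C, b + c ∈ A := by
    have hopen : IsOpen ((fun p : Z × Z => p.1 + p.2) ⁻¹' A) := hA.preimage continuous_add
    obtain ⟨B, C, hB, hC, haB, hC0, hBC⟩ := isOpen_prod_iff.1 hopen a 0 (by simpa using ha)
    exact ⟨B, C, hB, hC, haB, hC0, fun b hb c hc => hBC (mk_mem_prod hb hc)⟩
  obtain ⟨B, C, hB, hC, huB, hC0, hBC⟩ := hadd u hU hu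
  obtain ⟨D, E, hD, hE, hvD, hE0, hDE⟩ := hadd v hV hv
  obtain ⟨t, ht, ⟨_, ⟨b, hb, rfl⟩, hbW⟩, ⟨_, ⟨w, hw, rfl⟩, hwD⟩⟩ :=
    hR B D (C ∩ E) hB hD (hC.inter hE) ⟨u, huB⟩ ⟨v, hvD⟩ ⟨hC0, hE0⟩
  refine ⟨t, ht, b + w, hBC b hb w hw.1, ?_⟩
  rw [map_add, add_comm]
  exact hDE _ hwD _ hbW.2

/-- Finitely many nonempty open sets can be reached from a common nonempty open set. -/
theorem SatisfiesHC.exists_mapsTo {Z ι : Type*} [NormedAddCommGroup Z] [NormedSpace ℝ Z]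
    {R : ℝ → Z →L[ℝ] Z} (hR : SatisfiesHC R) (U : ι → Set Z) (hU : ∀ i, IsOpen (U i))
    (hU' : ∀ i, (U i).Nonempty) (F : Finset ι) :
    ∃ (A : Set Z) (s : ι → ℝ), IsOpen A ∧ A.Nonempty ∧
      ∀ i ∈ F, 0 ≤ s i ∧ MapsTo (R (s i)) A (U i) := by
  classical
  induction F using Finset.induction_on with
  | empty => exact ⟨univ, 0, isOpen_univ, ⟨0, mem_univ _⟩, by simp⟩
  | insert j F hj ih =>
    obtain ⟨A, s, hA, hA', hs⟩ := ih
    obtain ⟨t, ht, z, hz, hzt⟩ := hR.exists_mem_mem hA (hU j) hA' (hU' j)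
    refine ⟨A ∩ R t ⁻¹' U j, Function.update s j t,
      hA.inter ((hU j).preimage (R t).continuous), ⟨z, hz, hzt⟩, fun i hi => ?_⟩
    rcases eq_or_ne i j with rfl | hij
    · simpa using ⟨ht.le, fun x hx => hx.2⟩
    · have hi' := hs i ((Finset.mem_insert.1 hi).resolve_left hij)
      rw [Function.update_of_ne hij]
      exact ⟨hi'.1, hi'.2.mono_left inter_subset_left⟩

/-- For a commuting family, the hypercyclicity criterion holds simultaneously for finitely many
triples of open sets. -/
theorem SatisfiesHC.exists_forall {Z ι : Type*} [Finite ι] [NormedAddCommGroup Z]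
    [NormedSpace ℝ Z] {R : ℝ → Z →L[ℝ] Z} (hR : SatisfiesHC R)
    (hcomm : ∀ s t : ℝ, 0 ≤ s → 0 ≤ t → ∀ z, R s (R t z) = R t (R s z))
    (U V W : ι → Set Z) (hU : ∀ i, IsOpen (U i)) (hV : ∀ i, IsOpen (V i))
    (hW : ∀ i, IsOpen (W i)) (hU' : ∀ i, (U i).Nonempty) (hV' : ∀ i, (V i).Nonempty)
    (hW' : ∀ i, (0 : Z) ∈ W i) :
    ∃ t : ℝ, 0 < t ∧ ∀ i, (∃ u ∈ U i, R t u ∈ W i) ∧ ∃ w ∈ W i, R t w ∈ V i := by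
  cases nonempty_fintype ι
  obtain ⟨A, s, hA, hA', hs⟩ := hR.exists_mapsTo U hU hU' Finset.univ
  obtain ⟨B, r, hB, hB', hr⟩ := hR.exists_mapsTo V hV hV' Finset.univ
  obtain ⟨t, ht, ⟨_, ⟨u, hu, rfl⟩, huW⟩, ⟨_, ⟨w, hw, rfl⟩, hwB⟩⟩ :=
    hR A B (⋂ i, R (s i) ⁻¹' W i ∩ R (r i) ⁻¹' W i) hA hB
      (isOpen_iInter_of_finite fun i => ((hW i).preimage (R (s i)).continuous).inter
        ((hW i).preimage (R (r i)).continuous)) hA' hB' (by simpa using hW')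
  rw [mem_iInter] at huW hw
  refine ⟨t, ht, fun i => ?_⟩
  obtain ⟨hs0, hsm⟩ := hs i (Finset.mem_univ i)
  obtain ⟨hr0, hrm⟩ := hr i (Finset.mem_univ i)
  refine ⟨⟨R (s i) u, hsm hu, ?_⟩, ⟨R (r i) w, (hw i).2, ?_⟩⟩
  · rw [hcomm t (s i) ht.le hs0]
    exact (huW i).1
  · rw [hcomm t (r i) ht.le hr0]
    exact hrm hwB

/-- The operators of a strongly continuous semigroup commute. -/
theorem IsC0Semigroup.apply_comm {X : Type*} [NormedAddCommGroup X] [NormedSpace ℝ X]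
    {T : ℝ → X →L[ℝ] X} (hT : IsC0Semigroup T) {s t : ℝ} (hs : 0 ≤ s) (ht : 0 ≤ t) (x : X) :
    T s (T t x) = T t (T s x) := by
  rw [← ContinuousLinearMap.comp_apply, ← ContinuousLinearMap.comp_apply,
    ← hT.2.1 s t hs ht, ← hT.2.1 t s ht hs, add_comm]

/-- An open neighbourhood of `p` in `Xⁿ × Yⁿ` contains a product of open neighbourhoods of the
pairs `(p.1 i, p.2 i)`. -/
theorem exists_open_boxes {X Y ι : Type*} [Finite ι] [TopologicalSpace X] [TopologicalSpace Y]
    {U : Set ((ι → X) × (ι → Y))} (hU : IsOpen U) {p : (ι → X) × (ι → Y)} (hp : p ∈ U) :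
    ∃ u : ι → Set (X × Y), (∀ i, IsOpen (u i)) ∧ (∀ i, (p.1 i, p.2 i) ∈ u i) ∧
      ∀ f g, (∀ i, (f i, g i) ∈ u i) → (f, g) ∈ U := by
  let φ : (ι → X × Y) → (ι → X) × (ι → Y) := fun h => (fun i => (h i).1, fun i => (h i).2)
  have hφ : Continuous φ := by fun_prop
  obtain ⟨u, hu, huU⟩ := isOpen_pi_iff'.1 (hU.preimage hφ) (fun i => (p.1 i, p.2 i)) hp
  exact ⟨u, fun i => (hu i).1, fun i => (hu i).2, fun f g hfg =>
    huU (a := fun i => (f i, g i)) fun i _ => hfg i⟩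

/-- If the product semigroup `T(t) × S(t)` on `X × Y` (sup norm) satisfies the
hypercyclicity criterion, then so does `Tⁿ(t) × Sⁿ(t)` on `Xⁿ × Yⁿ` (sup norm). -/
theorem product_power_semigroup_satisfies_hypercyclicity_criterion
    {X Y : Type*} [NormedAddCommGroup X] [NormedSpace ℝ X] [CompleteSpace X]
    [TopologicalSpace.SeparableSpace X]
    [NormedAddCommGroup Y] [NormedSpace ℝ Y] [CompleteSpace Y]
    [TopologicalSpace.SeparableSpace Y]
    (T : ℝ → X →L[ℝ] X) (S : ℝ → Y →L[ℝ] Y)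
    (hT : IsC0Semigroup T) (hS : IsC0Semigroup S)
    (n : ℕ) (hn : 1 ≤ n)
    (hprod : SatisfiesHC (fun t => (T t).prodMap (S t))) :
    SatisfiesHC (fun t => (diagSg T n t).prodMap (diagSg S n t)) := by
  intro U V W hU hV hW ⟨p, hp⟩ ⟨q, hq⟩ hW0
  obtain ⟨u, hu, hpu, huU⟩ := exists_open_boxes hU hp
  obtain ⟨v, hv, hqv, hvV⟩ := exists_open_boxes hV hq
  obtain ⟨w, hw, hw0, hwW⟩ := exists_open_boxes hW hW0
  obtain ⟨t, ht, h⟩ := hprod.exists_forall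
    (fun s t hs ht z => Prod.ext (hT.apply_comm hs ht z.1) (hS.apply_comm hs ht z.2))
    u v w hu hv hw (fun i => ⟨_, hpu i⟩) (fun i => ⟨_, hqv i⟩) hw0
  choose a ha haw using fun i => (h i).1
  choose b hb hbv using fun i => (h i).2
  exact ⟨t, ht,
    ⟨_, mem_image_of_mem _ (huU (fun i => (a i).1) (fun i => (a i).2) ha), hwW _ _ haw⟩,
    ⟨_, mem_image_of_mem _ (hwW (fun i => (b i).1) (fun i => (b i).2) hb), hvV _ _ hbv⟩⟩
end
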